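/- Let A^{αβ}, for |α| = |β| = m, be simple coefficients (depending only on t) that are measurable, bounded by K, and satisfy the Legendre–Hadamard condition with constant λ > 0. Let R > 0 and let u ∈ C^∞(ℝ^{d+1}; ℝⁿ) satisfy ∂_t u + (−1)^m Σ_{|α|=|β|=m} A^{αβ}(t) D^{α+β} u = 0 for almost every (t,x) ∈ Q_{2R}. Then there exists a constant C depending only on d, n, m, λ, K such that for every X₀ ∈ Q_R and every 0 < r < R: ∫_{Q_r(X₀)} |u − (u)_{Q_r(X₀)}|² dx dt ≤ C (r/R)^{2+2m+d} ∫_{Q_R(X₀)} |u − (u)_{Q_R(X₀)}|² dx dt. -/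

import Mathlib

open MeasureTheory Metric Set Topology

noncomputable section

/-- The parabolic cylinder `Q_r(t₀,x₀) = (t₀ - r^{2m}, t₀) × B_r(x₀)`. -/
def QCyl (d m : ℕ) (r : ℝ) (X : ℝ × EuclideanSpace ℝ (Fin d)) :
    Set (ℝ × EuclideanSpace ℝ (Fin d)) :=
  Set.Ioo (X.1 - r ^ (2 * m)) X.1 ×ˢ Metric.ball X.2 r

/-- The upper-half parabolic cylinder, `i` being the index of the normal direction. -/
def QCylP (d m : ℕ) (i : Fin d) (r : ℝ) (X : ℝ × EuclideanSpace ℝ (Fin d)) :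
    Set (ℝ × EuclideanSpace ℝ (Fin d)) :=
  {p ∈ QCyl d m r X | 0 < p.2 i}

/-- Multi-indices of order exactly `k`. -/
def MIdx (d k : ℕ) : Finset (Fin d → ℕ) :=
  (Fintype.piFinset fun _ : Fin d => Finset.range (k + 1)).filter fun γ => ∑ i, γ i = k

/-- Multi-indices of order at most `k`. -/
def MIdxLe (d k : ℕ) : Finset (Fin d → ℕ) :=
  (Fintype.piFinset fun _ : Fin d => Finset.range (k + 1)).filter fun γ => ∑ i, γ i ≤ k

/-- Multi-indices of order strictly less than `k`. -/
def MIdxLt (d k : ℕ) : Finset (Fin d → ℕ) :=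
  (Fintype.piFinset fun _ : Fin d => Finset.range (k + 1)).filter fun γ => ∑ i, γ i < k

variable {d n : ℕ} {F : Type*} [NormedAddCommGroup F] [NormedSpace ℝ F]

/-- Spatial partial derivative in the `i`-th coordinate direction. -/
def pder (i : Fin d) (u : ℝ × EuclideanSpace ℝ (Fin d) → F) :
    ℝ × EuclideanSpace ℝ (Fin d) → F :=
  fun p => fderiv ℝ (fun y => u (p.1, y)) p.2 (EuclideanSpace.single i 1)

/-- Multi-index spatial derivative `D^γ`. -/
def Dmul (γ : Fin d → ℕ) (u : ℝ × EuclideanSpace ℝ (Fin d) → F) :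
    ℝ × EuclideanSpace ℝ (Fin d) → F :=
  (List.finRange d).foldr (fun i v => (pder i)^[γ i] v) u

/-- Time derivative `∂_t`. -/
def tder (u : ℝ × EuclideanSpace ℝ (Fin d) → F) : ℝ × EuclideanSpace ℝ (Fin d) → F :=
  fun p => deriv (fun s => u (s, p.2)) p.1

/-- The set of difference quotients entering the spatial Hölder seminorm `[f]*_{a,D}`. -/
def sHolderSet (a : ℝ) (D : Set (ℝ × EuclideanSpace ℝ (Fin d)))
    (f : ℝ × EuclideanSpace ℝ (Fin d) → F) : Set ℝ :=
  {c | ∃ p ∈ D, ∃ q ∈ D, p.1 = q.1 ∧ p.2 ≠ q.2 ∧ c = ‖f p - f q‖ / dist p.2 q.2 ^ a}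

/-- The spatial Hölder seminorm `[f]*_{a,D}`. -/
def sHolder (a : ℝ) (D : Set (ℝ × EuclideanSpace ℝ (Fin d)))
    (f : ℝ × EuclideanSpace ℝ (Fin d) → F) : ℝ :=
  sSup (sHolderSet a D f)

/-- The set of difference quotients entering the parabolic Hölder seminorm `[f]_{σ,a,D}`. -/
def pHolderSet (σ a : ℝ) (D : Set (ℝ × EuclideanSpace ℝ (Fin d)))
    (f : ℝ × EuclideanSpace ℝ (Fin d) → F) : Set ℝ :=
  {c | ∃ p ∈ D, ∃ q ∈ D, p ≠ q ∧ c = ‖f p - f q‖ / (|p.1 - q.1| ^ σ + dist p.2 q.2 ^ a)}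

/-- The parabolic Hölder seminorm `[f]_{σ,a,D}`. -/
def pHolder (σ a : ℝ) (D : Set (ℝ × EuclideanSpace ℝ (Fin d)))
    (f : ℝ × EuclideanSpace ℝ (Fin d) → F) : ℝ :=
  sSup (pHolderSet σ a D f)

/-- The set of difference quotients entering the time Hölder seminorm `⟨f⟩_{σ,D}`. -/
def tHolderSet (σ : ℝ) (D : Set (ℝ × EuclideanSpace ℝ (Fin d)))
    (f : ℝ × EuclideanSpace ℝ (Fin d) → F) : Set ℝ :=
  {c | ∃ p ∈ D, ∃ q ∈ D, p.2 = q.2 ∧ p.1 ≠ q.1 ∧ c = ‖f p - f q‖ / |p.1 - q.1| ^ σ}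

/-- The time Hölder seminorm `⟨f⟩_{σ,D}`. -/
def tHolder (σ : ℝ) (D : Set (ℝ × EuclideanSpace ℝ (Fin d)))
    (f : ℝ × EuclideanSpace ℝ (Fin d) → F) : ℝ :=
  sSup (tHolderSet σ D f)

/-- The `L^∞` norm over a set. -/
def LpInf (D : Set (ℝ × EuclideanSpace ℝ (Fin d)))
    (f : ℝ × EuclideanSpace ℝ (Fin d) → F) : ℝ :=
  (eLpNorm f ⊤ (volume.restrict D)).toReal

/-- The `L²` norm over a set. -/
def L2Norm (D : Set (ℝ × EuclideanSpace ℝ (Fin d)))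
    (f : ℝ × EuclideanSpace ℝ (Fin d) → F) : ℝ :=
  (eLpNorm f 2 (volume.restrict D)).toReal

/-- The Legendre–Hadamard ellipticity condition with constant `lam`. -/
def LegHad (d n m : ℕ) (lam : ℝ)
    (B : (Fin d → ℕ) → (Fin d → ℕ) → Fin n → Fin n → ℝ) : Prop :=
  ∀ (ξ : Fin n → ℝ) (η : Fin d → ℝ),
    lam * (∑ i, ξ i ^ 2) * (∑ k, η k ^ 2) ^ m ≤
      ∑ α ∈ MIdx d m, ∑ β ∈ MIdx d m, ∑ i, ∑ j,
        B α β i j * ξ i * ξ j * ((∏ k, η k ^ α k) * ∏ k, η k ^ β k)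

end

section Slices

open FourierTransform Real
open scoped ContDiff NNReal ENNReal

variable {d : ℕ}

/-- Partial derivative of a complex function of the space variable. -/
noncomputable def pd (i : Fin d) (g : EuclideanSpace ℝ (Fin d) → ℂ) :
    EuclideanSpace ℝ (Fin d) → ℂ :=
  fun x => fderiv ℝ g x (EuclideanSpace.single i 1)

/-- Iterated partial derivatives along a list of coordinate directions. -/
noncomputable def pds (l : List (Fin d)) (g : EuclideanSpace ℝ (Fin d) → ℂ) :
    EuclideanSpace ℝ (Fin d) → ℂ :=
  l.foldr pd g

/-- Fourier symbol of the `i`-th partial derivative. -/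
noncomputable def fsym (ξ : EuclideanSpace ℝ (Fin d)) (i : Fin d) : ℂ :=
  2 * π * Complex.I * (ξ i : ℂ)

/-- Smooth cutoff functions supported in the ball of radius `ρ`. -/
structure IsCut (ρ : ℝ) (ζ : EuclideanSpace ℝ (Fin d) → ℂ) : Prop where
  smooth : ContDiff ℝ ∞ ζ
  supp : tsupport ζ ⊆ ball 0 ρ

lemma contDiff_pd {g : EuclideanSpace ℝ (Fin d) → ℂ} (hg : ContDiff ℝ ∞ g) (i : Fin d) :
    ContDiff ℝ ∞ (pd i g) :=
  (hg.fderiv_right (m := ∞) (by simp)).clm_apply contDiff_const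

lemma contDiff_pds {g : EuclideanSpace ℝ (Fin d) → ℂ} (hg : ContDiff ℝ ∞ g) (l : List (Fin d)) :
    ContDiff ℝ ∞ (pds l g) := by
  induction l with
  | nil => exact hg
  | cons i l ih => exact contDiff_pd ih i

lemma IsCut.hasCompactSupport {ρ : ℝ} {ζ : EuclideanSpace ℝ (Fin d) → ℂ} (h : IsCut ρ ζ) :
    HasCompactSupport ζ :=
  HasCompactSupport.of_support_subset_isCompact (isCompact_closedBall 0 ρ)
    ((subset_tsupport ζ).trans (h.supp.trans ball_subset_closedBall))

lemma IsCut.partial {ρ : ℝ} {ζ : EuclideanSpace ℝ (Fin d) → ℂ} (h : IsCut ρ ζ) (i : Fin d) :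
    IsCut ρ (pd i ζ) :=
  ⟨contDiff_pd h.smooth i, (tsupport_fderiv_apply_subset ℝ _).trans h.supp⟩

lemma IsCut.mul {ρ : ℝ} {ζ g : EuclideanSpace ℝ (Fin d) → ℂ} (h : IsCut ρ ζ)
    (hg : ContDiff ℝ ∞ g) : IsCut ρ (fun x => ζ x * g x) :=
  ⟨h.smooth.mul hg, (tsupport_mul_subset_left (f := ζ) (g := g)).trans h.supp⟩

lemma IsCut.eq_zero {ρ : ℝ} {ζ : EuclideanSpace ℝ (Fin d) → ℂ} (h : IsCut ρ ζ)
    {x : EuclideanSpace ℝ (Fin d)} (hx : x ∉ ball (0 : EuclideanSpace ℝ (Fin d)) ρ) : ζ x = 0 :=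
  image_eq_zero_of_notMem_tsupport fun h' => hx (h.supp h')

lemma IsCut.exists_bound {ρ : ℝ} {ζ : EuclideanSpace ℝ (Fin d) → ℂ} (h : IsCut ρ ζ) :
    ∃ C : ℝ≥0, ∀ x, ‖ζ x‖₊ ≤ C := by
  obtain ⟨C, hC⟩ := h.hasCompactSupport.exists_bound_of_continuous h.smooth.continuous
  refine ⟨C.toNNReal, fun x => ?_⟩
  rw [← NNReal.coe_le_coe]
  simpa using Or.inl (hC x)

lemma exists_isCut {ρ' ρ : ℝ} (h0 : 0 < ρ') (h : ρ' < ρ) :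
    ∃ ζ : EuclideanSpace ℝ (Fin d) → ℂ, IsCut ρ ζ ∧ ∀ x ∈ ball 0 ρ', ζ x = 1 := by
  let b : ContDiffBump (0 : EuclideanSpace ℝ (Fin d)) :=
    ⟨ρ', (ρ' + ρ) / 2, h0, by linarith⟩
  refine ⟨fun x => (b x : ℂ), ⟨Complex.ofRealCLM.contDiff.comp b.contDiff, ?_⟩, fun x hx => ?_⟩
  · have : tsupport (fun x => (b x : ℂ)) ⊆ tsupport b :=
      closure_mono fun x hx hx' => hx (by simp [hx'])
    refine this.trans ?_
    rw [b.tsupport_eq]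
    exact closedBall_subset_ball (by change (ρ' + ρ) / 2 < ρ; linarith)
  · simp [b.one_of_mem_closedBall (ball_subset_closedBall hx)]

section Fourier

variable {ρ : ℝ} {h : EuclideanSpace ℝ (Fin d) → ℂ}

lemma IsCut.integrable (hh : IsCut ρ h) : Integrable h :=
  hh.smooth.continuous.integrable_of_hasCompactSupport hh.hasCompactSupport

lemma IsCut.continuous_fourier (hh : IsCut ρ h) : Continuous (𝓕 h) :=
  (𝓕 (hh.hasCompactSupport.toSchwartzMap hh.smooth)).continuous

lemma IsCut.lintegral_fourier (hh : IsCut ρ h) :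
    ∫⁻ ξ, ‖𝓕 h ξ‖ₑ ^ 2 = ∫⁻ x, ‖h x‖ₑ ^ 2 := by
  set f := hh.hasCompactSupport.toSchwartzMap hh.smooth
  have key (g : SchwartzMap (EuclideanSpace ℝ (Fin d)) ℂ) :
      ∫⁻ ξ, ‖g ξ‖ₑ ^ 2 = ENNReal.ofReal (∫ ξ, ‖g ξ‖ ^ 2) := by
    rw [ofReal_integral_eq_lintegral_ofReal]
    · simp [ENNReal.ofReal_pow]
    · exact (memLp_two_iff_integrable_sq_norm g.continuous.aestronglyMeasurable).1 (g.memLp 2)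
    · exact Filter.Eventually.of_forall fun x => by positivity
  have h1 := key (𝓕 f)
  rw [SchwartzMap.integral_norm_sq_fourier, ← key f] at h1
  exact h1

lemma IsCut.fourier_pd (hh : IsCut ρ h) (i : Fin d) (ξ : EuclideanSpace ℝ (Fin d)) :
    𝓕 (pd i h) ξ = fsym ξ i * 𝓕 h ξ := by
  have hd' : Integrable (fderiv ℝ h) :=
    (hh.smooth.continuous_fderiv (by simp)).integrable_of_hasCompactSupport
      (hh.hasCompactSupport.fderiv ℝ)
  have h1 := congrFun (fourier_fderiv hh.integrable (hh.smooth.differentiable (by simp)) hd') ξ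
  have h2 : 𝓕 (pd i h) ξ = 𝓕 (fderiv ℝ h) ξ (EuclideanSpace.single i 1) := by
    rw [Real.fourier_eq, Real.fourier_eq, ContinuousLinearMap.integral_apply]
    · rfl
    · exact (Real.fourierIntegral_convergent_iff ξ).2 hd'
  rw [h2, h1]
  have h3 : innerSL ℝ ξ (EuclideanSpace.single i 1) = ξ i := by
    rw [innerSL_apply_apply]
    simp [EuclideanSpace.inner_single_right]
  simp [fsym, h3]
  ring

lemma IsCut.enorm_le (hh : IsCut ρ h) (x : EuclideanSpace ℝ (Fin d)) :
    ‖h x‖ₑ ≤ ∫⁻ ξ, ‖𝓕 h ξ‖ₑ := by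
  set f := hh.hasCompactSupport.toSchwartzMap hh.smooth
  have h1 : 𝓕⁻ (𝓕 h) x = h x :=
    hh.integrable.fourierInv_fourier_eq (𝓕 f).integrable hh.smooth.continuous.continuousAt
  rw [← h1, Real.fourierInv_eq]
  refine (enorm_integral_le_lintegral_enorm _).trans (le_of_eq (lintegral_congr fun ξ => ?_))
  simp [← ofReal_norm, Circle.norm_smul]

lemma fourier_parts {ζ g : EuclideanSpace ℝ (Fin d) → ℂ} (hζ : IsCut ρ ζ) (hg : ContDiff ℝ ∞ g)
    (i : Fin d) (ξ : EuclideanSpace ℝ (Fin d)) :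
    𝓕 (fun x => ζ x * pd i g x) ξ =
      fsym ξ i * 𝓕 (fun x => ζ x * g x) ξ - 𝓕 (fun x => pd i ζ x * g x) ξ := by
  rw [← (hζ.mul hg).fourier_pd i ξ, eq_sub_iff_add_eq]
  have h1 := (hζ.mul (contDiff_pd hg i)).integrable
  have h2 := ((hζ.partial i).mul hg).integrable
  have h3 : pd i (fun x => ζ x * g x) =
      (fun x => ζ x * pd i g x) + fun x => pd i ζ x * g x := by
    funext x
    simp only [pd, Pi.add_apply]
    rw [fderiv_fun_mul (hζ.smooth.differentiable (by simp) x) (hg.differentiable (by simp) x)]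
    simp [mul_comm]
  rw [h3, Real.fourier_eq, Real.fourier_eq, Real.fourier_eq, ← integral_add]
  · simp [smul_add]
  · exact (Real.fourierIntegral_convergent_iff ξ).2 h1
  · exact (Real.fourierIntegral_convergent_iff ξ).2 h2

end Fourier

end Slices

section Weighted

open FourierTransform Real
open scoped ContDiff NNReal ENNReal

variable {d : ℕ}

/-- The weight `1 + |ξ|²`. -/
noncomputable def jap (ξ : EuclideanSpace ℝ (Fin d)) : ℝ := 1 + ‖ξ‖ ^ 2

/-- Squared Sobolev norm of order `k` over the set `S`. -/
noncomputable def sobSq (S : Set (EuclideanSpace ℝ (Fin d))) :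
    ℕ → (EuclideanSpace ℝ (Fin d) → ℂ) → ℝ≥0∞
  | 0, g => ∫⁻ x in S, ‖g x‖ₑ ^ 2
  | k + 1, g => sobSq S k g + ∑ i, sobSq S k (pd i g)

/-- Sum of the squares of the Fourier transforms of `g` cut off by the derivatives of `ζ` of order
at most `k`. -/
noncomputable def famSq : ℕ → (EuclideanSpace ℝ (Fin d) → ℂ) → (EuclideanSpace ℝ (Fin d) → ℂ) →
    EuclideanSpace ℝ (Fin d) → ℝ
  | 0, ζ, g, ξ => ‖𝓕 (fun x => ζ x * g x) ξ‖ ^ 2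
  | k + 1, ζ, g, ξ => famSq k ζ g ξ + ∑ i, famSq k (pd i ζ) g ξ

lemma one_le_jap (ξ : EuclideanSpace ℝ (Fin d)) : 1 ≤ jap ξ := by
  unfold jap; nlinarith [sq_nonneg ‖ξ‖]

lemma jap_pos (ξ : EuclideanSpace ℝ (Fin d)) : 0 < jap ξ :=
  zero_lt_one.trans_le (one_le_jap ξ)

lemma continuous_jap : Continuous (jap : EuclideanSpace ℝ (Fin d) → ℝ) := by
  unfold jap; fun_prop

lemma norm_fsym_sq (ξ : EuclideanSpace ℝ (Fin d)) (i : Fin d) :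
    ‖fsym ξ i‖ ^ 2 = 4 * π ^ 2 * ξ i ^ 2 := by
  simp [fsym, mul_pow]
  norm_num

lemma coord_sq_le_jap (ξ : EuclideanSpace ℝ (Fin d)) (i : Fin d) : ξ i ^ 2 ≤ jap ξ := by
  rw [jap, EuclideanSpace.real_norm_sq_eq]
  have := Finset.single_le_sum (f := fun i => ξ i ^ 2) (fun j _ => sq_nonneg _) (Finset.mem_univ i)
  simp only at this
  linarith

lemma norm_fsym_sq_le (ξ : EuclideanSpace ℝ (Fin d)) (i : Fin d) :
    ‖fsym ξ i‖ ^ 2 ≤ 4 * π ^ 2 * jap ξ := by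
  rw [norm_fsym_sq]
  gcongr
  exact coord_sq_le_jap ξ i

lemma famSq_nonneg (k : ℕ) (ζ g : EuclideanSpace ℝ (Fin d) → ℂ) (ξ : EuclideanSpace ℝ (Fin d)) :
    0 ≤ famSq k ζ g ξ := by
  induction k generalizing ζ with
  | zero => simp only [famSq]; positivity
  | succ k ih => exact add_nonneg (ih ζ) (Finset.sum_nonneg fun i _ => ih _)

lemma famSq_le_succ (k : ℕ) (ζ g : EuclideanSpace ℝ (Fin d) → ℂ)
    (ξ : EuclideanSpace ℝ (Fin d)) : famSq k ζ g ξ ≤ famSq (k + 1) ζ g ξ :=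
  le_add_of_nonneg_right (Finset.sum_nonneg fun _ _ => famSq_nonneg _ _ _ _)

lemma famSq_pd_le_succ (k : ℕ) (ζ g : EuclideanSpace ℝ (Fin d) → ℂ)
    (ξ : EuclideanSpace ℝ (Fin d)) (i : Fin d) :
    famSq k (pd i ζ) g ξ ≤ famSq (k + 1) ζ g ξ := by
  have := Finset.single_le_sum (f := fun i => famSq k (pd i ζ) g ξ)
    (fun j _ => famSq_nonneg _ _ _ _) (Finset.mem_univ i)
  simp only [famSq]
  linarith [famSq_nonneg k ζ g ξ]

lemma norm_sq_le_famSq (k : ℕ) (ζ g : EuclideanSpace ℝ (Fin d) → ℂ)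
    (ξ : EuclideanSpace ℝ (Fin d)) : ‖𝓕 (fun x => ζ x * g x) ξ‖ ^ 2 ≤ famSq k ζ g ξ := by
  induction k with
  | zero => exact le_rfl
  | succ k ih => exact ih.trans (famSq_le_succ k ζ g ξ)

lemma continuous_famSq {ρ : ℝ} (k : ℕ) {ζ g : EuclideanSpace ℝ (Fin d) → ℂ} (hζ : IsCut ρ ζ)
    (hg : ContDiff ℝ ∞ g) : Continuous (famSq k ζ g) := by
  induction k generalizing ζ with
  | zero => exact (hζ.mul hg).continuous_fourier.norm.pow 2
  | succ k ih => exact (ih hζ).add (continuous_finsetSum _ fun i _ => ih (hζ.partial i))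

lemma commutator_bound (l : List (Fin d)) :
    ∃ C : ℝ, 0 ≤ C ∧ ∀ (ρ : ℝ) (ζ g : EuclideanSpace ℝ (Fin d) → ℂ) (ξ : EuclideanSpace ℝ (Fin d)),
      IsCut ρ ζ → ContDiff ℝ ∞ g →
      jap ξ * ‖𝓕 (fun x => ζ x * pds l g x) ξ -
        (l.map (fsym ξ)).prod * 𝓕 (fun x => ζ x * g x) ξ‖ ^ 2 ≤
        C * jap ξ ^ l.length * famSq l.length ζ g ξ := by
  induction l with
  | nil => exact ⟨0, le_rfl, fun ρ ζ g ξ _ _ => by simp [pds]⟩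
  | cons i l ih =>
    obtain ⟨C, hC, ih⟩ := ih
    have hP (ξ : EuclideanSpace ℝ (Fin d)) :
        ‖(l.map (fsym ξ)).prod‖ ^ 2 ≤ (4 * π ^ 2 * jap ξ) ^ l.length := by
      clear ih
      induction l with
      | nil => simp
      | cons j l ihl =>
        simp only [List.map_cons, List.prod_cons, norm_mul, mul_pow _ _ 2, List.length_cons,
          pow_succ (4 * π ^ 2 * jap ξ)]
        rw [mul_comm]
        exact mul_le_mul ihl (norm_fsym_sq_le ξ j) (by positivity)
          (by have := jap_pos ξ; positivity)
    refine ⟨3 * (4 * π ^ 2 * C + C + (4 * π ^ 2) ^ l.length), by positivity,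
      fun ρ ζ g ξ hζ hg => ?_⟩
    have h1 := ih ρ ζ g ξ hζ hg
    have h2 := ih ρ (pd i ζ) g ξ (hζ.partial i) hg
    have hq := one_le_jap ξ
    have hq0 := jap_pos ξ
    have e : 𝓕 (fun x => ζ x * pds (i :: l) g x) ξ -
        ((i :: l).map (fsym ξ)).prod * 𝓕 (fun x => ζ x * g x) ξ =
        fsym ξ i * (𝓕 (fun x => ζ x * pds l g x) ξ -
          (l.map (fsym ξ)).prod * 𝓕 (fun x => ζ x * g x) ξ) -
        (𝓕 (fun x => pd i ζ x * pds l g x) ξ -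
          (l.map (fsym ξ)).prod * 𝓕 (fun x => pd i ζ x * g x) ξ) -
        (l.map (fsym ξ)).prod * 𝓕 (fun x => pd i ζ x * g x) ξ := by
      have := fourier_parts hζ (contDiff_pds hg l) i ξ
      change 𝓕 (fun x => ζ x * pd i (pds l g) x) ξ - _ = _
      rw [this]
      simp only [List.map_cons, List.prod_cons]
      ring
    rw [e]
    set a := 𝓕 (fun x => ζ x * pds l g x) ξ - (l.map (fsym ξ)).prod * 𝓕 (fun x => ζ x * g x) ξ
    set b := 𝓕 (fun x => pd i ζ x * pds l g x) ξ -
          (l.map (fsym ξ)).prod * 𝓕 (fun x => pd i ζ x * g x) ξ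
    set c := 𝓕 (fun x => pd i ζ x * g x) ξ with hc
    set p := (l.map (fsym ξ)).prod
    set k := l.length with hk
    have hF1 := famSq_le_succ k ζ g ξ
    have hF2 := famSq_pd_le_succ k ζ g ξ i
    have hF3 : ‖c‖ ^ 2 ≤ famSq (k + 1) ζ g ξ := (norm_sq_le_famSq k (pd i ζ) g ξ).trans hF2
    have hF0 := famSq_nonneg (k + 1) ζ g ξ
    have hn : ‖fsym ξ i * a - b - p * c‖ ^ 2 ≤
        3 * (‖fsym ξ i‖ ^ 2 * ‖a‖ ^ 2 + ‖b‖ ^ 2 + ‖p‖ ^ 2 * ‖c‖ ^ 2) := by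
      have : ‖fsym ξ i * a - b - p * c‖ ≤ ‖fsym ξ i‖ * ‖a‖ + ‖b‖ + ‖p‖ * ‖c‖ := by
        refine (norm_sub_le _ _).trans ?_
        rw [norm_mul p c]
        gcongr
        refine (norm_sub_le _ _).trans ?_
        rw [norm_mul]
      calc _ ≤ (‖fsym ξ i‖ * ‖a‖ + ‖b‖ + ‖p‖ * ‖c‖) ^ 2 := by gcongr
        _ ≤ _ := by
          nlinarith [sq_nonneg (‖fsym ξ i‖ * ‖a‖ - ‖b‖), sq_nonneg (‖fsym ξ i‖ * ‖a‖ - ‖p‖ * ‖c‖),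
            sq_nonneg (‖b‖ - ‖p‖ * ‖c‖)]
    have t1 : jap ξ * (‖fsym ξ i‖ ^ 2 * ‖a‖ ^ 2) ≤
        4 * π ^ 2 * C * (jap ξ ^ (k + 1) * famSq (k + 1) ζ g ξ) := by
      calc jap ξ * (‖fsym ξ i‖ ^ 2 * ‖a‖ ^ 2) = ‖fsym ξ i‖ ^ 2 * (jap ξ * ‖a‖ ^ 2) := by ring
        _ ≤ (4 * π ^ 2 * jap ξ) * (C * jap ξ ^ k * famSq (k + 1) ζ g ξ) := by
            refine mul_le_mul (norm_fsym_sq_le ξ i) (h1.trans ?_) (by positivity) (by positivity)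
            gcongr
        _ = _ := by ring
    have t2 : jap ξ * ‖b‖ ^ 2 ≤ C * (jap ξ ^ (k + 1) * famSq (k + 1) ζ g ξ) := by
      calc jap ξ * ‖b‖ ^ 2 ≤ C * jap ξ ^ k * famSq k (pd i ζ) g ξ := h2
        _ ≤ C * jap ξ ^ (k + 1) * famSq (k + 1) ζ g ξ := by
            have := famSq_nonneg k (pd i ζ) g ξ
            gcongr
            omega
        _ = _ := by ring
    have t3 : jap ξ * (‖p‖ ^ 2 * ‖c‖ ^ 2) ≤
        (4 * π ^ 2) ^ k * (jap ξ ^ (k + 1) * famSq (k + 1) ζ g ξ) := by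
      calc jap ξ * (‖p‖ ^ 2 * ‖c‖ ^ 2) ≤
          jap ξ * ((4 * π ^ 2 * jap ξ) ^ k * famSq (k + 1) ζ g ξ) := by
            gcongr
            exact hP ξ
        _ = _ := by rw [mul_pow]; ring
    rw [List.length_cons]
    nlinarith [mul_le_mul_of_nonneg_left hn hq0.le]

lemma lintegral_mul_fourier_le {ρ : ℝ} {ζ : EuclideanSpace ℝ (Fin d) → ℂ} (hζ : IsCut ρ ζ) :
    ∃ C : ℝ≥0, ∀ g : EuclideanSpace ℝ (Fin d) → ℂ, ContDiff ℝ ∞ g →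
      ∫⁻ ξ, ‖𝓕 (fun x => ζ x * g x) ξ‖ₑ ^ 2 ≤ C * ∫⁻ x in ball 0 ρ, ‖g x‖ₑ ^ 2 := by
  obtain ⟨C, hC⟩ := hζ.exists_bound
  refine ⟨C ^ 2, fun g hg => ?_⟩
  rw [(hζ.mul hg).lintegral_fourier, ← lintegral_const_mul' _ _ ENNReal.coe_ne_top,
    ← lintegral_indicator (measurableSet_ball (x := (0 : EuclideanSpace ℝ (Fin d))))]
  refine lintegral_mono fun x => ?_
  by_cases hx : x ∈ ball (0 : EuclideanSpace ℝ (Fin d)) ρ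
  · rw [indicator_of_mem hx, enorm_mul, mul_pow]
    gcongr
    rw [ENNReal.coe_pow]
    exact pow_le_pow_left₀ zero_le (ENNReal.coe_le_coe.2 (hC x)) 2
  · simp [hζ.eq_zero hx]

lemma enorm_sq_eq_ofReal (z : ℂ) : ‖z‖ₑ ^ 2 = ENNReal.ofReal (‖z‖ ^ 2) := by
  rw [ENNReal.ofReal_pow (norm_nonneg _), ofReal_norm]

lemma lintegral_jap_pow_fourier_le (k : ℕ) {ρ : ℝ} {ζ : EuclideanSpace ℝ (Fin d) → ℂ}
    (hζ : IsCut ρ ζ) :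
    ∃ C : ℝ≥0, ∀ g : EuclideanSpace ℝ (Fin d) → ℂ, ContDiff ℝ ∞ g →
      ∫⁻ ξ, ENNReal.ofReal (jap ξ ^ k * ‖𝓕 (fun x => ζ x * g x) ξ‖ ^ 2) ≤
        C * sobSq (ball 0 ρ) k g := by
  induction k generalizing ζ with
  | zero =>
    obtain ⟨C, hC⟩ := lintegral_mul_fourier_le hζ
    refine ⟨C, fun g hg => ?_⟩
    simp only [pow_zero, one_mul, sobSq, ← enorm_sq_eq_ofReal]
    exact hC g hg
  | succ k ih =>
    obtain ⟨C₀, h₀⟩ := ih hζ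
    choose C₁ h₁ using fun i => ih (hζ.partial i)
    refine ⟨C₀ + ∑ i, (2 * C₁ i + 2 * C₀), fun g hg => ?_⟩
    have hcont (η f : EuclideanSpace ℝ (Fin d) → ℂ) (hη : IsCut ρ η) (hf : ContDiff ℝ ∞ f) :
        Measurable fun ξ => ENNReal.ofReal (jap ξ ^ k * ‖𝓕 (fun x => η x * f x) ξ‖ ^ 2) :=
      (ENNReal.continuous_ofReal.comp ((continuous_jap.pow k).mul
        ((hη.mul hf).continuous_fourier.norm.pow 2))).measurable
    have hpt (ξ : EuclideanSpace ℝ (Fin d)) :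
        jap ξ ^ (k + 1) * ‖𝓕 (fun x => ζ x * g x) ξ‖ ^ 2 ≤
          jap ξ ^ k * ‖𝓕 (fun x => ζ x * g x) ξ‖ ^ 2 +
          ∑ i, (2 * (jap ξ ^ k * ‖𝓕 (fun x => pd i ζ x * g x) ξ‖ ^ 2) +
            2 * (jap ξ ^ k * ‖𝓕 (fun x => ζ x * pd i g x) ξ‖ ^ 2)) := by
      have hi (i : Fin d) : ξ i ^ 2 * ‖𝓕 (fun x => ζ x * g x) ξ‖ ^ 2 ≤
          2 * ‖𝓕 (fun x => pd i ζ x * g x) ξ‖ ^ 2 + 2 * ‖𝓕 (fun x => ζ x * pd i g x) ξ‖ ^ 2 := by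
        have h1 : ‖fsym ξ i * 𝓕 (fun x => ζ x * g x) ξ‖ ≤
            ‖𝓕 (fun x => pd i ζ x * g x) ξ‖ + ‖𝓕 (fun x => ζ x * pd i g x) ξ‖ := by
          rw [fourier_parts hζ hg i ξ]
          have := norm_add_le (𝓕 (fun x => pd i ζ x * g x) ξ)
            (fsym ξ i * 𝓕 (fun x => ζ x * g x) ξ - 𝓕 (fun x => pd i ζ x * g x) ξ)
          rwa [add_sub_cancel] at this
        have h2 : ξ i ^ 2 * ‖𝓕 (fun x => ζ x * g x) ξ‖ ^ 2 ≤
            ‖fsym ξ i * 𝓕 (fun x => ζ x * g x) ξ‖ ^ 2 := by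
          rw [norm_mul, mul_pow, norm_fsym_sq]
          gcongr
          have : 1 ≤ 4 * π ^ 2 := by nlinarith [pi_gt_three]
          nlinarith [sq_nonneg (ξ i)]
        have h3 := pow_le_pow_left₀ (norm_nonneg _) h1 2
        nlinarith [sq_nonneg (‖𝓕 (fun x => pd i ζ x * g x) ξ‖ - ‖𝓕 (fun x => ζ x * pd i g x) ξ‖)]
      have hs := Finset.sum_le_sum fun i (_ : i ∈ Finset.univ) => hi i
      rw [← Finset.sum_mul, ← EuclideanSpace.real_norm_sq_eq] at hs
      have hq : 0 ≤ jap ξ ^ k := pow_nonneg (jap_pos ξ).le k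
      have := mul_le_mul_of_nonneg_left hs hq
      rw [Finset.mul_sum] at this
      calc _ = jap ξ ^ k * ‖𝓕 (fun x => ζ x * g x) ξ‖ ^ 2 +
            jap ξ ^ k * (‖ξ‖ ^ 2 * ‖𝓕 (fun x => ζ x * g x) ξ‖ ^ 2) := by
              rw [pow_succ]; nth_rewrite 2 [jap]; ring
        _ ≤ _ := by
          gcongr
          refine this.trans (le_of_eq (Finset.sum_congr rfl fun i _ => by ring))
    calc _ ≤ ∫⁻ ξ, (ENNReal.ofReal (jap ξ ^ k * ‖𝓕 (fun x => ζ x * g x) ξ‖ ^ 2) +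
          ∑ i, (2 * ENNReal.ofReal (jap ξ ^ k * ‖𝓕 (fun x => pd i ζ x * g x) ξ‖ ^ 2) +
            2 * ENNReal.ofReal (jap ξ ^ k * ‖𝓕 (fun x => ζ x * pd i g x) ξ‖ ^ 2))) := by
          refine lintegral_mono fun ξ => ?_
          have hq : 0 ≤ jap ξ ^ k := pow_nonneg (jap_pos ξ).le k
          refine (ENNReal.ofReal_le_ofReal (hpt ξ)).trans (le_of_eq ?_)
          rw [ENNReal.ofReal_add (by positivity) (Finset.sum_nonneg fun i _ => by positivity),
            ENNReal.ofReal_sum_of_nonneg (fun i _ => add_nonneg (mul_nonneg (by norm_num)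
              (mul_nonneg hq (sq_nonneg _))) (mul_nonneg (by norm_num)
              (mul_nonneg hq (sq_nonneg _))))]
          congr 1
          refine Finset.sum_congr rfl fun i _ => ?_
          rw [ENNReal.ofReal_add (by positivity) (by positivity),
            ENNReal.ofReal_mul (p := 2) zero_le_two, ENNReal.ofReal_mul (p := 2) zero_le_two]
          simp only [ENNReal.ofReal_ofNat]
      _ = (∫⁻ ξ, ENNReal.ofReal (jap ξ ^ k * ‖𝓕 (fun x => ζ x * g x) ξ‖ ^ 2)) +
          ∑ i, (2 * (∫⁻ ξ, ENNReal.ofReal (jap ξ ^ k * ‖𝓕 (fun x => pd i ζ x * g x) ξ‖ ^ 2)) +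
            2 * ∫⁻ ξ, ENNReal.ofReal (jap ξ ^ k * ‖𝓕 (fun x => ζ x * pd i g x) ξ‖ ^ 2)) := by
          rw [lintegral_add_left (hcont ζ g hζ hg), lintegral_finsetSum]
          · congr 1
            refine Finset.sum_congr rfl fun i _ => ?_
            rw [lintegral_add_left ((hcont _ g (hζ.partial i) hg).const_mul 2),
              lintegral_const_mul _ (hcont _ g (hζ.partial i) hg),
              lintegral_const_mul _ (hcont ζ _ hζ (contDiff_pd hg i))]
          · intro i _
            exact ((hcont _ g (hζ.partial i) hg).const_mul 2).add
              ((hcont ζ _ hζ (contDiff_pd hg i)).const_mul 2)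
      _ ≤ C₀ * sobSq (ball 0 ρ) k g + ∑ i, (2 * (C₁ i * sobSq (ball 0 ρ) k g) +
            2 * (C₀ * sobSq (ball 0 ρ) k (pd i g))) := by
          gcongr with i
          · exact h₀ g hg
          · exact h₁ i g hg
          · exact h₀ _ (contDiff_pd hg i)
      _ ≤ C₀ * sobSq (ball 0 ρ) (k + 1) g + ∑ i, (2 * (C₁ i * sobSq (ball 0 ρ) (k + 1) g) +
            2 * (C₀ * sobSq (ball 0 ρ) (k + 1) g)) := by
          have hm : sobSq (ball 0 ρ) k g ≤ sobSq (ball 0 ρ) (k + 1) g := le_self_add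
          have hm' (i : Fin d) : sobSq (ball 0 ρ) k (pd i g) ≤ sobSq (ball 0 ρ) (k + 1) g :=
            (Finset.single_le_sum (f := fun i => sobSq (ball 0 ρ) k (pd i g))
              (fun _ _ => zero_le) (Finset.mem_univ i)).trans le_add_self
          gcongr with i
          exact hm' i
      _ = _ := by
          push_cast
          rw [add_mul, Finset.sum_mul]
          congr 1
          refine Finset.sum_congr rfl fun i _ => ?_
          ring

lemma lintegral_jap_pow_famSq_le (k K : ℕ) {ρ : ℝ} {ζ : EuclideanSpace ℝ (Fin d) → ℂ}
    (hζ : IsCut ρ ζ) :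
    ∃ C : ℝ≥0, ∀ g : EuclideanSpace ℝ (Fin d) → ℂ, ContDiff ℝ ∞ g →
      ∫⁻ ξ, ENNReal.ofReal (jap ξ ^ k * famSq K ζ g ξ) ≤ C * sobSq (ball 0 ρ) k g := by
  induction K generalizing ζ with
  | zero => exact lintegral_jap_pow_fourier_le k hζ
  | succ K ih =>
    obtain ⟨C₀, h₀⟩ := ih hζ
    choose C₁ h₁ using fun i => ih (hζ.partial i)
    refine ⟨C₀ + ∑ i, C₁ i, fun g hg => ?_⟩
    have hcont (η : EuclideanSpace ℝ (Fin d) → ℂ) (hη : IsCut ρ η) :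
        Measurable fun ξ => ENNReal.ofReal (jap ξ ^ k * famSq K η g ξ) :=
      (ENNReal.continuous_ofReal.comp ((continuous_jap.pow k).mul
        (continuous_famSq K hη hg))).measurable
    calc _ = ∫⁻ ξ, (ENNReal.ofReal (jap ξ ^ k * famSq K ζ g ξ) +
          ∑ i, ENNReal.ofReal (jap ξ ^ k * famSq K (pd i ζ) g ξ)) := by
          refine lintegral_congr fun ξ => ?_
          have hq : 0 ≤ jap ξ ^ k := pow_nonneg (jap_pos ξ).le k
          rw [famSq, mul_add, Finset.mul_sum, ENNReal.ofReal_add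
            (mul_nonneg hq (famSq_nonneg _ _ _ _))
            (Finset.sum_nonneg fun i _ => mul_nonneg hq (famSq_nonneg _ _ _ _)),
            ENNReal.ofReal_sum_of_nonneg (fun i _ => mul_nonneg hq (famSq_nonneg _ _ _ _))]
      _ = (∫⁻ ξ, ENNReal.ofReal (jap ξ ^ k * famSq K ζ g ξ)) +
          ∑ i, ∫⁻ ξ, ENNReal.ofReal (jap ξ ^ k * famSq K (pd i ζ) g ξ) := by
          rw [lintegral_add_left (hcont ζ hζ), lintegral_finsetSum]
          exact fun i _ => hcont _ (hζ.partial i)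
      _ ≤ C₀ * sobSq (ball 0 ρ) k g + ∑ i, C₁ i * sobSq (ball 0 ρ) k g := by
          gcongr with i
          · exact h₀ g hg
          · exact h₁ i g hg
      _ = _ := by
          push_cast
          rw [add_mul, Finset.sum_mul]

lemma enorm_sq_le_lintegral_jap (d : ℕ) :
    ∃ C : ℝ≥0, ∀ (ρ : ℝ) (h : EuclideanSpace ℝ (Fin d) → ℂ), IsCut ρ h →
      ∀ x, ‖h x‖ₑ ^ 2 ≤ C * ∫⁻ ξ, ENNReal.ofReal (jap ξ ^ (2 * (d + 1)) * ‖𝓕 h ξ‖ ^ 2) := by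
  let J := ∫⁻ ξ : EuclideanSpace ℝ (Fin d), ENNReal.ofReal ((jap ξ ^ (2 * (d + 1)))⁻¹)
  have hJ : J ≠ ⊤ := by
    have : Integrable fun ξ : EuclideanSpace ℝ (Fin d) => (jap ξ ^ (2 * (d + 1)))⁻¹ := by
      have h := integrable_rpow_neg_one_add_norm_sq (E := EuclideanSpace ℝ (Fin d)) (μ := volume)
        (r := 2 * ((2 * (d + 1) : ℕ) : ℝ)) (by simp; linarith)
      refine h.congr (Filter.Eventually.of_forall fun ξ => ?_)
      have e : -(2 * ((2 * (d + 1) : ℕ) : ℝ)) / 2 = -((2 * (d + 1) : ℕ) : ℝ) := by ring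
      simp only [e]
      rw [Real.rpow_neg (by positivity), Real.rpow_natCast, jap]
    exact this.lintegral_lt_top.ne
  refine ⟨J.toNNReal, fun ρ h hh x => ?_⟩
  rw [ENNReal.coe_toNNReal hJ]
  have hf : Measurable fun ξ : EuclideanSpace ℝ (Fin d) =>
      ENNReal.ofReal ((jap ξ ^ (d + 1))⁻¹) :=
    (continuous_jap.measurable.pow_const _).inv.ennreal_ofReal
  have hg : Measurable fun ξ : EuclideanSpace ℝ (Fin d) =>
      ENNReal.ofReal (jap ξ ^ (d + 1) * ‖𝓕 h ξ‖) :=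
    (((continuous_jap.pow _).mul hh.continuous_fourier.norm).measurable).ennreal_ofReal
  have hH := ENNReal.lintegral_mul_le_Lp_mul_Lq volume (Real.HolderConjugate.two_two)
    hf.aemeasurable hg.aemeasurable
  have e1 : ∫⁻ ξ, ‖𝓕 h ξ‖ₑ = ∫⁻ ξ, ((fun ξ : EuclideanSpace ℝ (Fin d) =>
      ENNReal.ofReal ((jap ξ ^ (d + 1))⁻¹)) * (fun ξ : EuclideanSpace ℝ (Fin d) =>
      ENNReal.ofReal (jap ξ ^ (d + 1) * ‖𝓕 h ξ‖)) : EuclideanSpace ℝ (Fin d) → ℝ≥0∞) ξ := by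
    refine lintegral_congr fun ξ => ?_
    have := jap_pos ξ
    rw [Pi.mul_apply, ← ENNReal.ofReal_mul (by positivity), inv_mul_cancel_left₀ (by positivity),
      ofReal_norm]
  rw [← e1] at hH
  have h2 := pow_le_pow_left₀ (zero_le) ((hh.enorm_le x).trans hH) 2
  refine h2.trans (le_of_eq ?_)
  rw [mul_pow, ← ENNReal.rpow_natCast, ← ENNReal.rpow_natCast, ← ENNReal.rpow_mul,
    ← ENNReal.rpow_mul]
  norm_num
  congr 1
  · refine lintegral_congr fun ξ => ?_
    rw [← ENNReal.ofReal_pow (by have := jap_pos ξ; positivity), inv_pow, ← pow_mul, mul_comm 2]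
  · refine lintegral_congr fun ξ => ?_
    rw [← ENNReal.ofReal_pow (by have := jap_pos ξ; positivity), mul_pow, ← pow_mul, mul_comm 2]

end Weighted

section Energy

open FourierTransform Real
open scoped ContDiff NNReal ENNReal ComplexConjugate

variable {d : ℕ}

/-- The list of directions, with multiplicity, of a multi-index. -/
def dirs (γ : Fin d → ℕ) : List (Fin d) :=
  (List.finRange d).flatMap fun i => List.replicate (γ i) i

lemma length_dirs (γ : Fin d → ℕ) : (dirs γ).length = ∑ i, γ i := by
  simp [dirs, List.length_flatMap, ← Fin.sum_univ_def]

lemma prod_dirs (γ : Fin d → ℕ) (f : Fin d → ℂ) : ((dirs γ).map f).prod = ∏ i, f i ^ γ i := by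
  simp only [dirs, List.map_flatMap, List.map_replicate, Fin.prod_univ_def]
  induction List.finRange d with
  | nil => simp
  | cons i l ih => simp [ih]

lemma Dmul_slice (γ : Fin d → ℕ) (v : ℝ × EuclideanSpace ℝ (Fin d) → ℂ) (t : ℝ)
    (x : EuclideanSpace ℝ (Fin d)) :
    Dmul γ v (t, x) = pds (dirs γ) (fun y => v (t, y)) x := by
  have key (l : List (Fin d)) :
      (fun y => l.foldr (fun i v => (pder i)^[γ i] v) v (t, y)) =
        pds (l.flatMap fun i => List.replicate (γ i) i) (fun y => v (t, y)) := by
    induction l with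
    | nil => rfl
    | cons i l ih =>
      have h (k : ℕ) : (fun y => ((pder i)^[k] (l.foldr (fun i v => (pder i)^[γ i] v) v)) (t, y)) =
          pds (List.replicate k i ++ l.flatMap fun i => List.replicate (γ i) i)
            (fun y => v (t, y)) := by
        induction k with
        | zero => simpa using ih
        | succ k ihk =>
          rw [Function.iterate_succ_apply', List.replicate_succ, List.cons_append]
          change _ = pd i (pds _ _)
          rw [← ihk]
          rfl
      simpa using h (γ i)
  exact congrFun (key (List.finRange d)) x

lemma prod_fsym (ξ : EuclideanSpace ℝ (Fin d)) {m : ℕ} {α β : Fin d → ℕ} (hα : α ∈ MIdx d m)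
    (hβ : β ∈ MIdx d m) :
    ((dirs (α + β)).map (fsym ξ)).prod =
      (-1) ^ m * (2 * π) ^ (2 * m) * ((∏ k, ξ k ^ α k) * ∏ k, ξ k ^ β k : ℝ) := by
  have h1 : ∑ i, (α + β) i = 2 * m := by
    have ha := (Finset.mem_filter.1 hα).2
    have hb := (Finset.mem_filter.1 hβ).2
    simp only [Pi.add_apply, Finset.sum_add_distrib, ha, hb]
    ring
  rw [prod_dirs]
  simp only [fsym, mul_pow, Finset.prod_mul_distrib, Finset.prod_pow_eq_pow_sum, h1]
  rw [pow_mul Complex.I, Complex.I_sq]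
  simp only [Pi.add_apply, pow_add, Finset.prod_mul_distrib]
  push_cast
  ring

lemma length_dirs_add {m : ℕ} {α β : Fin d → ℕ} (hα : α ∈ MIdx d m) (hβ : β ∈ MIdx d m) :
    (dirs (α + β)).length = 2 * m := by
  have ha := (Finset.mem_filter.1 hα).2
  have hb := (Finset.mem_filter.1 hβ).2
  simp only [length_dirs, Pi.add_apply, Finset.sum_add_distrib, ha, hb]
  ring

lemma fourier_sum {ι : Type*} (s : Finset ι) (c : ι → ℂ)
    (f : ι → EuclideanSpace ℝ (Fin d) → ℂ) (hf : ∀ k ∈ s, Integrable (f k))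
    (ξ : EuclideanSpace ℝ (Fin d)) :
    𝓕 (fun x => ∑ k ∈ s, c k * f k x) ξ = ∑ k ∈ s, c k * 𝓕 (f k) ξ := by
  simp only [Real.fourier_eq]
  rw [← Finset.sum_congr rfl fun k _ => integral_const_mul (c k) _, ← integral_finsetSum]
  · refine integral_congr_ae (Filter.Eventually.of_forall fun x => ?_)
    simp only [Finset.smul_sum, Circle.smul_def, smul_eq_mul]
    exact Finset.sum_congr rfl fun k _ => by ring
  · exact fun k hk => ((Real.fourierIntegral_convergent_iff ξ).2 (hf k hk)).const_mul _

lemma LegHad.complex {n m : ℕ} {lam : ℝ} {B : (Fin d → ℕ) → (Fin d → ℕ) → Fin n → Fin n → ℝ}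
    (hB : LegHad d n m lam B) (z : Fin n → ℂ) (ξ : EuclideanSpace ℝ (Fin d)) :
    lam * (∑ i, ‖z i‖ ^ 2) * (‖ξ‖ ^ 2) ^ m ≤
      ∑ i, (conj (z i) * ∑ α ∈ MIdx d m, ∑ β ∈ MIdx d m, ∑ j,
        (B α β i j : ℂ) * ((∏ k, ξ k ^ α k) * ∏ k, ξ k ^ β k : ℝ) * z j).re := by
  have h1 := hB (fun i => (z i).re) ξ
  have h2 := hB (fun i => (z i).im) ξ
  have e1 : ∑ i, ‖z i‖ ^ 2 = ∑ i, (z i).re ^ 2 + ∑ i, (z i).im ^ 2 := by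
    rw [← Finset.sum_add_distrib]
    refine Finset.sum_congr rfl fun i _ => ?_
    rw [← Complex.normSq_eq_norm_sq, Complex.normSq_apply]
    ring
  rw [e1, EuclideanSpace.real_norm_sq_eq]
  have e2 (i : Fin n) : (conj (z i) * ∑ α ∈ MIdx d m, ∑ β ∈ MIdx d m, ∑ j,
      (B α β i j : ℂ) * ((∏ k, ξ k ^ α k) * ∏ k, ξ k ^ β k : ℝ) * z j).re =
      ∑ α ∈ MIdx d m, ∑ β ∈ MIdx d m, ∑ j, B α β i j *
      ((∏ k, ξ k ^ α k) * ∏ k, ξ k ^ β k) *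
        ((z i).re * (z j).re + (z i).im * (z j).im) := by
    simp only [Finset.mul_sum, Complex.re_sum]
    refine Finset.sum_congr rfl fun α _ => Finset.sum_congr rfl fun β _ =>
      Finset.sum_congr rfl fun j _ => ?_
    have : conj (z i) * ((B α β i j : ℂ) * ((∏ k, ξ k ^ α k) * ∏ k, ξ k ^ β k : ℝ) * z j) =
      ((B α β i j * ((∏ k, ξ k ^ α k) * ∏ k, ξ k ^ β k) : ℝ) : ℂ) * (conj (z i) * z j) := by
      push_cast; ring
    rw [this, Complex.re_ofReal_mul]
    simp
  rw [mul_add, add_mul]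
  refine (add_le_add h1 h2).trans (le_of_eq ?_)
  simp only [e2, ← Finset.sum_add_distrib]
  rw [Finset.sum_comm (s := Finset.univ) (t := MIdx d m)]
  refine Finset.sum_congr rfl fun α _ => ?_
  rw [Finset.sum_comm (s := Finset.univ) (t := MIdx d m)]
  refine Finset.sum_congr rfl fun β _ => Finset.sum_congr rfl fun i _ =>
    Finset.sum_congr rfl fun j _ => ?_
  ring

lemma jap_pow_le (m : ℕ) (ξ : EuclideanSpace ℝ (Fin d)) :
    jap ξ ^ m ≤ 2 ^ m * ((‖ξ‖ ^ 2) ^ m + 1) := by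
  have h0 : 0 ≤ ‖ξ‖ ^ 2 := by positivity
  rcases le_total (‖ξ‖ ^ 2) 1 with h | h
  · calc jap ξ ^ m ≤ 2 ^ m := by
          refine pow_le_pow_left₀ (jap_pos ξ).le ?_ m
          unfold jap; linarith
      _ ≤ _ := by
          have : 0 ≤ (‖ξ‖ ^ 2) ^ m := by positivity
          have h2 : (0 : ℝ) < 2 ^ m := by positivity
          nlinarith
  · calc jap ξ ^ m ≤ (2 * ‖ξ‖ ^ 2) ^ m := by
          refine pow_le_pow_left₀ (jap_pos ξ).le ?_ m
          unfold jap; linarith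
      _ ≤ _ := by
          rw [mul_pow]
          have h2 : (0 : ℝ) < 2 ^ m := by positivity
          nlinarith

/-- The remainder left after replacing the operator by its symbol. -/
lemma remainder_bound (n m : ℕ) (K : ℝ) :
    ∃ C : ℝ, 0 ≤ C ∧ ∀ B : (Fin d → ℕ) → (Fin d → ℕ) → Fin n → Fin n → ℝ,
      (∀ α β i j, |B α β i j| ≤ K) →
      ∀ (ρ : ℝ) (ζ : EuclideanSpace ℝ (Fin d) → ℂ), IsCut ρ ζ →
      ∀ (g h : Fin n → EuclideanSpace ℝ (Fin d) → ℂ), (∀ j, ContDiff ℝ ∞ (g j)) →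
      (∀ x ∈ ball 0 ρ, ∀ i, h i x = -((-1) ^ m * ∑ α ∈ MIdx d m, ∑ β ∈ MIdx d m, ∑ j,
        (B α β i j : ℂ) * pds (dirs (α + β)) (g j) x)) →
      ∀ ξ i, jap ξ * ‖𝓕 (fun x => ζ x * h i x) ξ + (2 * π) ^ (2 * m) *
        ∑ α ∈ MIdx d m, ∑ β ∈ MIdx d m, ∑ j, (B α β i j : ℂ) *
          ((∏ k, ξ k ^ α k) * ∏ k, ξ k ^ β k : ℝ) * 𝓕 (fun x => ζ x * g j x) ξ‖ ^ 2 ≤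
        C * jap ξ ^ (2 * m) * ∑ j, famSq (2 * m) ζ (g j) ξ := by
  choose Cc hCc0 hCc using commutator_bound (d := d)
  let I := (MIdx d m ×ˢ MIdx d m) ×ˢ (Finset.univ : Finset (Fin n))
  refine ⟨I.card * ∑ k ∈ I, K ^ 2 * Cc (dirs (k.1.1 + k.1.2)), by
    have := fun l => hCc0 l
    have h : 0 ≤ ∑ k ∈ I, K ^ 2 * Cc (dirs (k.1.1 + k.1.2)) :=
      Finset.sum_nonneg fun k _ => mul_nonneg (sq_nonneg _) (this _)
    positivity, fun B hB ρ ζ hζ g h hg hgh ξ i => ?_⟩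
  have e0 (f : (Fin d → ℕ) → (Fin d → ℕ) → Fin n → ℂ) :
      ∑ α ∈ MIdx d m, ∑ β ∈ MIdx d m, ∑ j, f α β j = ∑ k ∈ I, f k.1.1 k.1.2 k.2 := by
    simp only [I, Finset.sum_product]
  have e1 : (fun x => ζ x * h i x) = fun x => ∑ k ∈ I,
      (-((-1) ^ m * (B k.1.1 k.1.2 i k.2 : ℂ))) *
        (fun x => ζ x * pds (dirs (k.1.1 + k.1.2)) (g k.2) x) x := by
    funext x
    by_cases hx : x ∈ ball (0 : EuclideanSpace ℝ (Fin d)) ρ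
    · rw [hgh x hx i, e0 (fun α β j => (B α β i j : ℂ) * pds (dirs (α + β)) (g j) x),
        Finset.mul_sum, ← Finset.sum_neg_distrib, Finset.mul_sum]
      exact Finset.sum_congr rfl fun k _ => by ring
    · simp [hζ.eq_zero hx]
  rw [e1, fourier_sum I _ (fun k x => ζ x * pds (dirs (k.1.1 + k.1.2)) (g k.2) x)
    (fun k _ => (hζ.mul (contDiff_pds (hg _) _)).integrable), e0, Finset.mul_sum,
    ← Finset.sum_add_distrib]
  have e2 : ∀ k ∈ I, -((-1) ^ m * (B k.1.1 k.1.2 i k.2 : ℂ)) *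
        𝓕 (fun x => ζ x * pds (dirs (k.1.1 + k.1.2)) (g k.2) x) ξ +
      (2 * π) ^ (2 * m) * ((B k.1.1 k.1.2 i k.2 : ℂ) *
        ((∏ l, ξ l ^ k.1.1 l) * ∏ l, ξ l ^ k.1.2 l : ℝ) * 𝓕 (fun x => ζ x * g k.2 x) ξ) =
      -((-1) ^ m * (B k.1.1 k.1.2 i k.2 : ℂ)) *
        (𝓕 (fun x => ζ x * pds (dirs (k.1.1 + k.1.2)) (g k.2) x) ξ -
          ((dirs (k.1.1 + k.1.2)).map (fsym ξ)).prod * 𝓕 (fun x => ζ x * g k.2 x) ξ) := by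
    intro k hk
    simp only [I, Finset.mem_product] at hk
    rw [prod_fsym ξ hk.1.1 hk.1.2]
    have : ((-1 : ℂ) ^ m) * (-1) ^ m = 1 := by rw [← mul_pow]; simp
    linear_combination (-(B k.1.1 k.1.2 i k.2 : ℂ) * (2 * π) ^ (2 * m) *
      ((∏ l, ξ l ^ k.1.1 l) * ∏ l, ξ l ^ k.1.2 l : ℝ) * 𝓕 (fun x => ζ x * g k.2 x) ξ) * this
  rw [Finset.sum_congr rfl e2]
  set G := ∑ j, famSq (2 * m) ζ (g j) ξ
  have hG : 0 ≤ G := Finset.sum_nonneg fun j _ => famSq_nonneg _ _ _ _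
  have h3 : ∀ k ∈ I, jap ξ * ‖-((-1) ^ m * (B k.1.1 k.1.2 i k.2 : ℂ)) *
        (𝓕 (fun x => ζ x * pds (dirs (k.1.1 + k.1.2)) (g k.2) x) ξ -
          ((dirs (k.1.1 + k.1.2)).map (fsym ξ)).prod * 𝓕 (fun x => ζ x * g k.2 x) ξ)‖ ^ 2 ≤
      (K ^ 2 * Cc (dirs (k.1.1 + k.1.2))) * (jap ξ ^ (2 * m) * G) := by
    intro k hk
    simp only [I, Finset.mem_product] at hk
    have h4 := hCc (dirs (k.1.1 + k.1.2)) ρ ζ (g k.2) ξ hζ (hg _)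
    rw [length_dirs_add hk.1.1 hk.1.2] at h4
    have h5 : famSq (2 * m) ζ (g k.2) ξ ≤ G :=
      Finset.single_le_sum (f := fun j => famSq (2 * m) ζ (g j) ξ)
        (fun j _ => famSq_nonneg _ _ _ _) (Finset.mem_univ _)
    rw [norm_mul, mul_pow]
    have h6 : ‖-((-1) ^ m * (B k.1.1 k.1.2 i k.2 : ℂ))‖ ^ 2 ≤ K ^ 2 := by
      simp only [norm_neg, norm_mul, norm_pow, norm_one, one_pow, one_mul, Complex.norm_real,
        Real.norm_eq_abs]
      exact pow_le_pow_left₀ (abs_nonneg _) (hB _ _ _ _) 2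
    calc _ = ‖-((-1) ^ m * (B k.1.1 k.1.2 i k.2 : ℂ))‖ ^ 2 * (jap ξ * _) := mul_left_comm _ _ _
      _ ≤ K ^ 2 * (Cc (dirs (k.1.1 + k.1.2)) * jap ξ ^ (2 * m) * G) := by
        refine mul_le_mul h6 (h4.trans ?_) (mul_nonneg (jap_pos ξ).le (by positivity))
          (sq_nonneg _)
        exact mul_le_mul_of_nonneg_left h5
          (mul_nonneg (hCc0 _) (pow_nonneg (jap_pos ξ).le _))
      _ = _ := by ring
  calc _ ≤ jap ξ * (I.card * ∑ k ∈ I, ‖-((-1) ^ m * (B k.1.1 k.1.2 i k.2 : ℂ)) *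
        (𝓕 (fun x => ζ x * pds (dirs (k.1.1 + k.1.2)) (g k.2) x) ξ -
          ((dirs (k.1.1 + k.1.2)).map (fsym ξ)).prod * 𝓕 (fun x => ζ x * g k.2 x) ξ)‖ ^ 2) := by
        refine mul_le_mul_of_nonneg_left ?_ (jap_pos ξ).le
        exact (pow_le_pow_left₀ (norm_nonneg _) (norm_sum_le _ _) 2).trans
          (sq_sum_le_card_mul_sum_sq)
    _ = I.card * ∑ k ∈ I, jap ξ * ‖-((-1) ^ m * (B k.1.1 k.1.2 i k.2 : ℂ)) *
        (𝓕 (fun x => ζ x * pds (dirs (k.1.1 + k.1.2)) (g k.2) x) ξ -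
          ((dirs (k.1.1 + k.1.2)).map (fsym ξ)).prod * 𝓕 (fun x => ζ x * g k.2 x) ξ)‖ ^ 2 := by
        rw [Finset.mul_sum, Finset.mul_sum, Finset.mul_sum]
        exact Finset.sum_congr rfl fun k _ => by ring
    _ ≤ I.card * ∑ k ∈ I, (K ^ 2 * Cc (dirs (k.1.1 + k.1.2))) * (jap ξ ^ (2 * m) * G) :=
        mul_le_mul_of_nonneg_left (Finset.sum_le_sum h3) (Nat.cast_nonneg _)
    _ = _ := by rw [← Finset.sum_mul]; ring

/-- Pointwise energy inequality on the Fourier side. -/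
lemma energy_pointwise (n : ℕ) {m : ℕ} (hm : 1 ≤ m) (K lam : ℝ) (hlam : 0 < lam) :
    ∃ c C : ℝ, 0 < c ∧ 0 ≤ C ∧ ∀ B : (Fin d → ℕ) → (Fin d → ℕ) → Fin n → Fin n → ℝ,
      (∀ α β i j, |B α β i j| ≤ K) → LegHad d n m lam B →
      ∀ (ρ : ℝ) (ζ : EuclideanSpace ℝ (Fin d) → ℂ), IsCut ρ ζ →
      ∀ (g h : Fin n → EuclideanSpace ℝ (Fin d) → ℂ), (∀ j, ContDiff ℝ ∞ (g j)) →
      (∀ x ∈ ball 0 ρ, ∀ i, h i x = -((-1) ^ m * ∑ α ∈ MIdx d m, ∑ β ∈ MIdx d m, ∑ j,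
        (B α β i j : ℂ) * pds (dirs (α + β)) (g j) x)) →
      ∀ ξ, jap ξ * (2 * ∑ i, (conj (𝓕 (fun x => ζ x * g i x) ξ) *
          𝓕 (fun x => ζ x * h i x) ξ).re) ≤
        -c * jap ξ ^ (m + 1) * ∑ i, ‖𝓕 (fun x => ζ x * g i x) ξ‖ ^ 2 +
          C * jap ξ ^ m * ∑ j, famSq (2 * m) ζ (g j) ξ := by
  obtain ⟨Cr, hCr0, hCr⟩ := remainder_bound (d := d) n m K
  set a : ℝ := lam * (2 * π) ^ (2 * m) with ha
  have ha0 : 0 < a := by positivity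
  set b : ℝ := a / 2 ^ m with hb
  have hb0 : 0 < b := by positivity
  refine ⟨b, n * Cr / b + 2 * a, hb0, by positivity, fun B hB hLH ρ ζ hζ g h hg hgh ξ => ?_⟩
  set z : Fin n → ℂ := fun i => 𝓕 (fun x => ζ x * g i x) ξ with hz
  set S : Fin n → ℂ := fun i => ∑ α ∈ MIdx d m, ∑ β ∈ MIdx d m, ∑ j, (B α β i j : ℂ) *
          ((∏ k, ξ k ^ α k) * ∏ k, ξ k ^ β k : ℝ) * z j with hS
  set rem : Fin n → ℂ := fun i => 𝓕 (fun x => ζ x * h i x) ξ + (2 * π) ^ (2 * m) * S i with hrem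
  set G := ∑ j, famSq (2 * m) ζ (g j) ξ with hG
  set P := jap ξ ^ m with hP
  have hJ := one_le_jap ξ
  have hP0 : 0 < P := pow_pos (jap_pos ξ) m
  have hJP : jap ξ ≤ P := le_self_pow₀ hJ (by omega)
  have h1 := hCr B hB ρ ζ hζ g h hg hgh ξ
  have h2 : lam * (∑ i, ‖z i‖ ^ 2) * (‖ξ‖ ^ 2) ^ m ≤ ∑ i, (conj (z i) * S i).re :=
    hLH.complex z ξ
  set Y := ∑ i, ‖z i‖ ^ 2 with hY
  have hY0 : 0 ≤ Y := Finset.sum_nonneg fun i _ => sq_nonneg _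
  have hYG : Y ≤ G := Finset.sum_le_sum fun j _ => norm_sq_le_famSq _ _ _ _
  have h3 (i : Fin n) : (conj (z i) * 𝓕 (fun x => ζ x * h i x) ξ).re =
      (conj (z i) * rem i).re - (2 * π) ^ (2 * m) * (conj (z i) * S i).re := by
    have : conj (z i) * 𝓕 (fun x => ζ x * h i x) ξ =
        conj (z i) * rem i - (((2 * π) ^ (2 * m) : ℝ) : ℂ) * (conj (z i) * S i) := by
      simp only [hrem]; push_cast; ring
    rw [this, Complex.sub_re, Complex.re_ofReal_mul]
  have h4 (i : Fin n) : jap ξ * (2 * (conj (z i) * rem i).re) ≤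
      b * P * jap ξ * ‖z i‖ ^ 2 + Cr / b * P * G := by
    have h5 : (conj (z i) * rem i).re ≤ ‖z i‖ * ‖rem i‖ := by
      refine (Complex.re_le_norm _).trans ?_
      simp
    have h6 : jap ξ * ‖rem i‖ ^ 2 ≤ Cr * (P * P) * G := by
      have e : jap ξ ^ (2 * m) = P * P := by rw [two_mul, pow_add]
      rw [← e]
      exact h1 i
    have h7 : jap ξ * (2 * (conj (z i) * rem i).re) * (b * P) ≤
        (b * P * jap ξ * ‖z i‖ ^ 2 + Cr / b * P * G) * (b * P) := by
      have e : Cr / b * P * G * (b * P) = Cr * (P * P) * G := by field_simp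
      rw [add_mul, e]
      refine le_trans ?_ (add_le_add_right h6 _)
      have := mul_le_mul_of_nonneg_left h5 (by positivity : 0 ≤ jap ξ * 2 * (b * P))
      have h8 := mul_nonneg (jap_pos ξ).le (sq_nonneg (b * P * ‖z i‖ - ‖rem i‖))
      nlinarith
    exact le_of_mul_le_mul_right h7 (by positivity)
  have h5 : jap ξ * (2 * ∑ i, (conj (z i) * rem i).re) ≤
      b * P * jap ξ * Y + n * (Cr / b * P * G) := by
    have := Finset.sum_le_sum fun i (_ : i ∈ Finset.univ) => h4 i
    simp only [Finset.sum_add_distrib, ← Finset.mul_sum, Finset.sum_const, Finset.card_univ,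
      Fintype.card_fin, nsmul_eq_mul] at this
    exact this.trans (le_of_eq (by ring))
  have h6 : P ≤ 2 ^ m * ((‖ξ‖ ^ 2) ^ m + 1) := jap_pow_le m ξ
  have h7 : b * P ≤ a * ((‖ξ‖ ^ 2) ^ m + 1) := by
    have e : a = b * 2 ^ m := by rw [hb]; field_simp
    rw [e, mul_assoc]
    exact mul_le_mul_of_nonneg_left h6 hb0.le
  have h8 : b * P * Y - a * Y ≤ (2 * π) ^ (2 * m) * ∑ i, (conj (z i) * S i).re := by
    have h9 := mul_le_mul_of_nonneg_left h2 (by positivity : 0 ≤ (2 * π) ^ (2 * m))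
    have h10 := mul_le_mul_of_nonneg_right h7 hY0
    have e : (2 * π) ^ (2 * m) * (lam * Y * (‖ξ‖ ^ 2) ^ m) = a * (‖ξ‖ ^ 2) ^ m * Y := by
      rw [ha]; ring
    linarith
  have h9 : jap ξ * (b * P * Y - a * Y) ≤
      jap ξ * ((2 * π) ^ (2 * m) * ∑ i, (conj (z i) * S i).re) :=
    mul_le_mul_of_nonneg_left h8 (jap_pos ξ).le
  have h10 : jap ξ * Y ≤ P * G := mul_le_mul hJP hYG hY0 hP0.le
  have h11 := mul_le_mul_of_nonneg_left h10 ha0.le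
  have e3 : ∑ i, (conj (𝓕 (fun x => ζ x * g i x) ξ) * 𝓕 (fun x => ζ x * h i x) ξ).re =
      ∑ i, (conj (z i) * rem i).re - (2 * π) ^ (2 * m) * ∑ i, (conj (z i) * S i).re :=
    (Finset.sum_congr rfl fun i _ => h3 i).trans
      (by rw [Finset.sum_sub_distrib, ← Finset.mul_sum])
  rw [e3, pow_succ]
  change _ ≤ -b * (P * jap ξ) * Y + (n * Cr / b + 2 * a) * P * G
  have e : (n * Cr / b + 2 * a) * P * G = n * (Cr / b * P * G) + 2 * (a * (P * G)) := by ring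
  rw [e]
  linarith

end Energy

section Slices

open FourierTransform Real
open scoped ContDiff NNReal ENNReal ComplexConjugate

variable {d : ℕ}

lemma contDiff_slice {F : Type*} [NormedAddCommGroup F] [NormedSpace ℝ F]
    {W : ℝ × EuclideanSpace ℝ (Fin d) → F} (hW : ContDiff ℝ ∞ W) (t : ℝ) :
    ContDiff ℝ ∞ fun x => W (t, x) :=
  hW.comp (contDiff_const.prodMk contDiff_id)

lemma pder_eq_fderiv {F : Type*} [NormedAddCommGroup F] [NormedSpace ℝ F]
    {W : ℝ × EuclideanSpace ℝ (Fin d) → F} (hW : ContDiff ℝ ∞ W) (i : Fin d) :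
    pder i W = fun p => fderiv ℝ W p (0, EuclideanSpace.single i 1) := by
  funext p
  have h1 : HasFDerivAt W (fderiv ℝ W (p.1, p.2)) (p.1, p.2) :=
    (hW.differentiable (by simp)).differentiableAt.hasFDerivAt
  have h2 := h1.comp p.2 (hasFDerivAt_prodMk_right p.1 p.2)
  unfold pder
  erw [h2.fderiv]
  simp

lemma tder_eq_fderiv {F : Type*} [NormedAddCommGroup F] [NormedSpace ℝ F]
    {W : ℝ × EuclideanSpace ℝ (Fin d) → F} (hW : ContDiff ℝ ∞ W) :
    tder W = fun p => fderiv ℝ W p (1, 0) := by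
  funext p
  have h1 : HasFDerivAt W (fderiv ℝ W (p.1, p.2)) (p.1, p.2) :=
    (hW.differentiable (by simp)).differentiableAt.hasFDerivAt
  have h2 := (h1.comp p.1 (hasFDerivAt_prodMk_left p.1 p.2)).hasDerivAt
  unfold tder
  erw [h2.deriv]
  simp

lemma contDiff_pder {F : Type*} [NormedAddCommGroup F] [NormedSpace ℝ F]
    {W : ℝ × EuclideanSpace ℝ (Fin d) → F} (hW : ContDiff ℝ ∞ W) (i : Fin d) :
    ContDiff ℝ ∞ (pder i W) := by
  rw [pder_eq_fderiv hW]
  exact (hW.fderiv_right (m := ∞) (by simp)).clm_apply contDiff_const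

lemma contDiff_tder {F : Type*} [NormedAddCommGroup F] [NormedSpace ℝ F]
    {W : ℝ × EuclideanSpace ℝ (Fin d) → F} (hW : ContDiff ℝ ∞ W) :
    ContDiff ℝ ∞ (tder W) := by
  rw [tder_eq_fderiv hW]
  exact (hW.fderiv_right (m := ∞) (by simp)).clm_apply contDiff_const

lemma hasDerivAt_tder {F : Type*} [NormedAddCommGroup F] [NormedSpace ℝ F]
    {W : ℝ × EuclideanSpace ℝ (Fin d) → F} (hW : ContDiff ℝ ∞ W) (t : ℝ)
    (x : EuclideanSpace ℝ (Fin d)) : HasDerivAt (fun s => W (s, x)) (tder W (t, x)) t :=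
  ((hW.comp (contDiff_id.prodMk contDiff_const)).differentiable
    (by simp)).differentiableAt.hasDerivAt

lemma fderiv_fderiv_apply_comm {V F : Type*} [NormedAddCommGroup V] [NormedSpace ℝ V]
    [NormedAddCommGroup F] [NormedSpace ℝ F] {f : V → F} (hf : ContDiff ℝ ∞ f) (v w p : V) :
    fderiv ℝ (fun q => fderiv ℝ f q v) p w = fderiv ℝ (fun q => fderiv ℝ f q w) p v := by
  have hd : DifferentiableAt ℝ (fderiv ℝ f) p :=
    ((hf.fderiv_right (m := ∞) (by simp)).differentiable (by simp)).differentiableAt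
  have hs : IsSymmSndFDerivAt ℝ f p :=
    (hf.contDiffAt (x := p)).isSymmSndFDerivAt (by
      rw [minSmoothness_of_isRCLikeNormedField]; exact WithTop.coe_le_coe.2 (le_top : (2 : ℕ∞) ≤ ⊤))
  rw [fderiv_clm_apply hd (differentiableAt_const v), fderiv_clm_apply hd (differentiableAt_const w)]
  simpa using hs w v

lemma tder_pder {F : Type*} [NormedAddCommGroup F] [NormedSpace ℝ F]
    {W : ℝ × EuclideanSpace ℝ (Fin d) → F} (hW : ContDiff ℝ ∞ W) (i : Fin d) :
    tder (pder i W) = pder i (tder W) := by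
  rw [tder_eq_fderiv (contDiff_pder hW i), pder_eq_fderiv (contDiff_tder hW),
    pder_eq_fderiv hW, tder_eq_fderiv hW]
  funext p
  exact fderiv_fderiv_apply_comm hW _ _ p

lemma pd_comm {g : EuclideanSpace ℝ (Fin d) → ℂ} (hg : ContDiff ℝ ∞ g) (i j : Fin d) :
    pd i (pd j g) = pd j (pd i g) := by
  funext x
  exact fderiv_fderiv_apply_comm hg _ _ x

lemma pds_pd {g : EuclideanSpace ℝ (Fin d) → ℂ} (hg : ContDiff ℝ ∞ g) (l : List (Fin d))
    (i : Fin d) : pds l (pd i g) = pd i (pds l g) := by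
  induction l with
  | nil => rfl
  | cons j l ih =>
    change pd j (pds l (pd i g)) = pd i (pd j (pds l g))
    rw [ih, pd_comm (contDiff_pds hg l)]

lemma fourier_slice_eq {ρ : ℝ} {ζ : EuclideanSpace ℝ (Fin d) → ℂ} (hζ : IsCut ρ ζ)
    (W : ℝ × EuclideanSpace ℝ (Fin d) → ℂ) (t : ℝ) (ξ : EuclideanSpace ℝ (Fin d)) :
    𝓕 (fun x => ζ x * W (t, x)) ξ =
      ∫ x in closedBall 0 ρ, (𝐞 (-(inner ℝ x ξ)) : ℂ) * (ζ x * W (t, x)) := by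
  rw [Real.fourier_eq, setIntegral_eq_integral_of_forall_compl_eq_zero]
  · rfl
  · intro x hx
    rw [hζ.eq_zero fun h => hx (ball_subset_closedBall h)]
    simp

lemma continuous_kernel {ρ : ℝ} {ζ : EuclideanSpace ℝ (Fin d) → ℂ} (hζ : IsCut ρ ζ)
    {W : ℝ × EuclideanSpace ℝ (Fin d) → ℂ} (hW : ContDiff ℝ ∞ W) :
    Continuous fun q : (ℝ × EuclideanSpace ℝ (Fin d)) × EuclideanSpace ℝ (Fin d) =>
      (𝐞 (-(inner ℝ q.2 q.1.2)) : ℂ) * (ζ q.2 * W (q.1.1, q.2)) := by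
  have h1 := hζ.smooth.continuous
  have h2 := hW.continuous
  have h3 := Real.continuous_fourierChar
  fun_prop

lemma continuous_fourier_slice {ρ : ℝ} {ζ : EuclideanSpace ℝ (Fin d) → ℂ} (hζ : IsCut ρ ζ)
    {W : ℝ × EuclideanSpace ℝ (Fin d) → ℂ} (hW : ContDiff ℝ ∞ W) :
    Continuous fun p : ℝ × EuclideanSpace ℝ (Fin d) => 𝓕 (fun x => ζ x * W (p.1, x)) p.2 := by
  simp only [fourier_slice_eq hζ]
  exact continuous_parametric_integral_of_continuous (continuous_kernel hζ hW)
    (isCompact_closedBall 0 ρ)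

lemma continuous_famSq_slice (k : ℕ) {ρ : ℝ} {ζ : EuclideanSpace ℝ (Fin d) → ℂ}
    (hζ : IsCut ρ ζ) {W : ℝ × EuclideanSpace ℝ (Fin d) → ℂ} (hW : ContDiff ℝ ∞ W) :
    Continuous fun p : ℝ × EuclideanSpace ℝ (Fin d) => famSq k ζ (fun x => W (p.1, x)) p.2 := by
  induction k generalizing ζ with
  | zero => exact (continuous_fourier_slice hζ hW).norm.pow 2
  | succ k ih => exact (ih hζ).add (continuous_finsetSum _ fun i _ => ih (hζ.partial i))

lemma hasDerivAt_integral_kernel {k : EuclideanSpace ℝ (Fin d) → ℂ} (hk : Continuous k)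
    {W : ℝ × EuclideanSpace ℝ (Fin d) → ℂ} (hW : ContDiff ℝ ∞ W) (t ρ : ℝ) :
    HasDerivAt (fun s => ∫ x in closedBall 0 ρ, k x * W (s, x))
      (∫ x in closedBall 0 ρ, k x * tder W (t, x)) t := by
  have hc {V : ℝ × EuclideanSpace ℝ (Fin d) → ℂ} (hV : ContDiff ℝ ∞ V) :
      Continuous fun q : ℝ × EuclideanSpace ℝ (Fin d) => k q.2 * V (q.1, q.2) := by
    have h2 := hV.continuous
    fun_prop
  obtain ⟨C, hC⟩ := ((isCompact_closedBall t 1).prod (isCompact_closedBall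
    (0 : EuclideanSpace ℝ (Fin d)) ρ)).exists_bound_of_continuousOn
      (hc (contDiff_tder hW)).continuousOn
  have hs {V : ℝ × EuclideanSpace ℝ (Fin d) → ℂ} (hV : ContDiff ℝ ∞ V) (s : ℝ) :
      Continuous fun x => k x * V (s, x) :=
    hk.mul (contDiff_slice hV s).continuous
  refine (hasDerivAt_integral_of_dominated_loc_of_deriv_le (bound := fun _ => C)
    (F' := fun s x => k x * tder W (s, x)) (ball_mem_nhds t one_pos)
    (Filter.Eventually.of_forall fun s => (hs hW s).aestronglyMeasurable)
    ((hs hW t).continuousOn.integrableOn_compact (isCompact_closedBall _ _))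
    (hs (contDiff_tder hW) t).aestronglyMeasurable ?_
    (integrableOn_const (isCompact_closedBall _ _).measure_lt_top.ne)
    (Filter.Eventually.of_forall fun x s _ => (hasDerivAt_tder hW s x).const_mul _)).2
  filter_upwards [ae_restrict_mem measurableSet_closedBall] with x hx s hs'
  exact hC (s, x) ⟨ball_subset_closedBall hs', hx⟩

lemma hasDerivAt_fourier_slice {ρ : ℝ} {ζ : EuclideanSpace ℝ (Fin d) → ℂ} (hζ : IsCut ρ ζ)
    {W : ℝ × EuclideanSpace ℝ (Fin d) → ℂ} (hW : ContDiff ℝ ∞ W) (t : ℝ)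
    (ξ : EuclideanSpace ℝ (Fin d)) :
    HasDerivAt (fun s => 𝓕 (fun x => ζ x * W (s, x)) ξ) (𝓕 (fun x => ζ x * tder W (t, x)) ξ) t := by
  have hk : Continuous fun x => (𝐞 (-(inner ℝ x ξ)) : ℂ) * ζ x := by
    have h1 := hζ.smooth.continuous
    have h3 := Real.continuous_fourierChar
    fun_prop
  have h := hasDerivAt_integral_kernel hk hW t ρ
  simp only [mul_assoc] at h
  simp only [fourier_slice_eq hζ]
  exact h

end Slices

section TimeEnergy

open FourierTransform Real
open scoped ContDiff NNReal ENNReal ComplexConjugate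

variable {d n m : ℕ}

/-- Bounded simple coefficients satisfying the Legendre–Hadamard condition. -/
structure IsCoef (d n m : ℕ) (K lam : ℝ)
    (A : (Fin d → ℕ) → (Fin d → ℕ) → ℝ → Fin n → Fin n → ℝ) : Prop where
  bound : ∀ α β t i j, |A α β t i j| ≤ K
  leg : ∀ t, LegHad d n m lam fun α β => A α β t

/-- Smooth complex solutions of the system in the unit cylinder, for almost every time. -/
structure IsSol (d n m : ℕ) (A : (Fin d → ℕ) → (Fin d → ℕ) → ℝ → Fin n → Fin n → ℝ)
    (W : Fin n → ℝ × EuclideanSpace ℝ (Fin d) → ℂ) : Prop where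
  smooth : ∀ j, ContDiff ℝ ∞ (W j)
  eqn : ∀ᵐ t ∂(volume.restrict (Ioo (-1 : ℝ) 0)), ∀ x ∈ ball (0 : EuclideanSpace ℝ (Fin d)) 1,
    ∀ i, tder (W i) (t, x) = -((-1) ^ m * ∑ α ∈ MIdx d m, ∑ β ∈ MIdx d m, ∑ j,
      (A α β t i j : ℂ) * Dmul (α + β) (W j) (t, x))

lemma IsSol.partial {A : (Fin d → ℕ) → (Fin d → ℕ) → ℝ → Fin n → Fin n → ℝ}
    {W : Fin n → ℝ × EuclideanSpace ℝ (Fin d) → ℂ} (h : IsSol d n m A W) (i : Fin d) :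
    IsSol d n m A fun j => pder i (W j) := by
  refine ⟨fun j => contDiff_pder (h.smooth j) i, ?_⟩
  filter_upwards [h.eqn] with t ht x hx k
  have h1 : (fun y => tder (W k) (t, y)) =ᶠ[𝓝 x] fun y => -((-1) ^ m * ∑ α ∈ MIdx d m,
      ∑ β ∈ MIdx d m, ∑ j, (A α β t k j : ℂ) * pds (dirs (α + β)) (fun y => W j (t, y)) y) := by
    filter_upwards [isOpen_ball.mem_nhds hx] with y hy
    rw [ht y hy k]
    simp only [Dmul_slice]
  rw [tder_pder (h.smooth k)]
  change fderiv ℝ (fun y => tder (W k) (t, y)) x _ = _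
  rw [h1.fderiv_eq]
  have hd (α β : Fin d → ℕ) (j : Fin n) := (((contDiff_pds (contDiff_slice (h.smooth j) t)
    (dirs (α + β))).differentiable (by simp)).differentiableAt (x := x)).hasFDerivAt.const_mul
      (A α β t k j : ℂ)
  have h2 := ((HasFDerivAt.fun_sum fun α (_ : α ∈ MIdx d m) => HasFDerivAt.fun_sum
    fun β (_ : β ∈ MIdx d m) => HasFDerivAt.fun_sum fun j (_ : j ∈ Finset.univ) =>
      hd α β j).const_mul ((-1 : ℂ) ^ m)).neg
  erw [h2.fderiv]
  simp only [Dmul_slice, neg_apply, smul_apply,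
    sum_apply, smul_eq_mul]
  refine congrArg _ (congrArg _ (Finset.sum_congr rfl fun α _ => Finset.sum_congr rfl fun β _ =>
    Finset.sum_congr rfl fun j _ => ?_))
  change _ = _ * pds (dirs (α + β)) (pd i fun y => W j (t, y)) x
  rw [pds_pd (contDiff_slice (h.smooth j) t)]
  rfl

/-- Squared Fourier modulus of a localized system. -/
noncomputable def modSq (ζ : EuclideanSpace ℝ (Fin d) → ℂ)
    (W : Fin n → ℝ × EuclideanSpace ℝ (Fin d) → ℂ) (t : ℝ) (ξ : EuclideanSpace ℝ (Fin d)) : ℝ :=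
  ∑ i, ‖𝓕 (fun x => ζ x * W i (t, x)) ξ‖ ^ 2

/-- Sum of the squared Fourier moduli over the cutoff derivatives, for a localized system. -/
noncomputable def famSum (k : ℕ) (ζ : EuclideanSpace ℝ (Fin d) → ℂ)
    (W : Fin n → ℝ × EuclideanSpace ℝ (Fin d) → ℂ) (t : ℝ) (ξ : EuclideanSpace ℝ (Fin d)) : ℝ :=
  ∑ j, famSq k ζ (fun x => W j (t, x)) ξ

section

variable {ρ : ℝ} {ζ : EuclideanSpace ℝ (Fin d) → ℂ}
  {W : Fin n → ℝ × EuclideanSpace ℝ (Fin d) → ℂ}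

lemma modSq_nonneg (t : ℝ) (ξ : EuclideanSpace ℝ (Fin d)) : 0 ≤ modSq ζ W t ξ :=
  Finset.sum_nonneg fun _ _ => sq_nonneg _

lemma famSum_nonneg (k : ℕ) (t : ℝ) (ξ : EuclideanSpace ℝ (Fin d)) : 0 ≤ famSum k ζ W t ξ :=
  Finset.sum_nonneg fun _ _ => famSq_nonneg _ _ _ _

lemma modSq_le_famSum (k : ℕ) (t : ℝ) (ξ : EuclideanSpace ℝ (Fin d)) :
    modSq ζ W t ξ ≤ famSum k ζ W t ξ :=
  Finset.sum_le_sum fun _ _ => norm_sq_le_famSq _ _ _ _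

lemma continuous_modSq (hζ : IsCut ρ ζ) (hW : ∀ j, ContDiff ℝ ∞ (W j)) :
    Continuous fun p : ℝ × EuclideanSpace ℝ (Fin d) => modSq ζ W p.1 p.2 :=
  continuous_finsetSum _ fun j _ => (continuous_fourier_slice hζ (hW j)).norm.pow 2

lemma continuous_famSum (k : ℕ) (hζ : IsCut ρ ζ) (hW : ∀ j, ContDiff ℝ ∞ (W j)) :
    Continuous fun p : ℝ × EuclideanSpace ℝ (Fin d) => famSum k ζ W p.1 p.2 :=
  continuous_finsetSum _ fun j _ => continuous_famSq_slice k hζ (hW j)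

lemma continuous_modSq_time (hζ : IsCut ρ ζ) (hW : ∀ j, ContDiff ℝ ∞ (W j))
    (ξ : EuclideanSpace ℝ (Fin d)) : Continuous fun t => modSq ζ W t ξ := by
  have h := (continuous_modSq hζ hW).comp (Continuous.prodMk_left ξ)
  simpa only [Function.comp_def] using h

lemma continuous_famSum_time (k : ℕ) (hζ : IsCut ρ ζ) (hW : ∀ j, ContDiff ℝ ∞ (W j))
    (ξ : EuclideanSpace ℝ (Fin d)) : Continuous fun t => famSum k ζ W t ξ := by
  have h := (continuous_famSum k hζ hW).comp (Continuous.prodMk_left ξ)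
  simpa only [Function.comp_def] using h

lemma continuous_fourier_time (hζ : IsCut ρ ζ) {V : ℝ × EuclideanSpace ℝ (Fin d) → ℂ}
    (hV : ContDiff ℝ ∞ V) (ξ : EuclideanSpace ℝ (Fin d)) :
    Continuous fun t => 𝓕 (fun x => ζ x * V (t, x)) ξ := by
  have h := (continuous_fourier_slice hζ hV).comp (Continuous.prodMk_left ξ)
  simpa only [Function.comp_def] using h

/-- Time derivative of `modSq`. -/
noncomputable def modSqDeriv (ζ : EuclideanSpace ℝ (Fin d) → ℂ)
    (W : Fin n → ℝ × EuclideanSpace ℝ (Fin d) → ℂ) (t : ℝ) (ξ : EuclideanSpace ℝ (Fin d)) : ℝ :=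
  2 * ∑ i, (conj (𝓕 (fun x => ζ x * W i (t, x)) ξ) * 𝓕 (fun x => ζ x * tder (W i) (t, x)) ξ).re

lemma hasDerivAt_modSq (hζ : IsCut ρ ζ) (hW : ∀ j, ContDiff ℝ ∞ (W j)) (t : ℝ)
    (ξ : EuclideanSpace ℝ (Fin d)) :
    HasDerivAt (fun s => modSq ζ W s ξ) (modSqDeriv ζ W t ξ) t := by
  unfold modSqDeriv
  rw [Finset.mul_sum]
  refine HasDerivAt.fun_sum fun i _ => ?_
  refine (hasDerivAt_fourier_slice hζ (hW i) t ξ).norm_sq.congr_deriv ?_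
  rw [Complex.inner, mul_comm (starRingEnd ℂ _)]

lemma continuous_modSqDeriv (hζ : IsCut ρ ζ) (hW : ∀ j, ContDiff ℝ ∞ (W j))
    (ξ : EuclideanSpace ℝ (Fin d)) : Continuous fun s => modSqDeriv ζ W s ξ := by
  have c1 (i : Fin n) := continuous_fourier_time hζ (hW i) ξ
  have c2 (i : Fin n) := continuous_fourier_time hζ (contDiff_tder (hW i)) ξ
  unfold modSqDeriv
  refine continuous_const.mul (continuous_finsetSum _ fun i _ => ?_)
  exact Complex.continuous_re.comp ((Complex.continuous_conj.comp (c1 i)).mul (c2 i))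

end

lemma energy_integrated (d n : ℕ) {m : ℕ} (hm : 1 ≤ m) (K lam : ℝ) (hlam : 0 < lam) :
    ∃ c C : ℝ, 0 < c ∧ 0 ≤ C ∧ ∀ A, IsCoef d n m K lam A → ∀ W, IsSol d n m A W →
      ∀ (ρ : ℝ) (ζ : EuclideanSpace ℝ (Fin d) → ℂ), ρ ≤ 1 → IsCut ρ ζ →
      ∀ ξ, ∀ t ∈ Icc (-ρ) 0, jap ξ * ((t + ρ) * modSq ζ W t ξ) +
          c * jap ξ ^ (m + 1) * ∫ s in (-ρ)..t, (s + ρ) * modSq ζ W s ξ ≤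
        C * jap ξ ^ m * ∫ s in (-ρ)..t, famSum (2 * m) ζ W s ξ := by
  obtain ⟨c, C, hc, hC, key⟩ := energy_pointwise (d := d) n hm K lam hlam
  refine ⟨c, C + 1, hc, by positivity, fun A hA W hW ρ ζ hρ1 hζ ξ t ht => ?_⟩
  set y' : ℝ → ℝ := fun s => modSq ζ W s ξ + (s + ρ) * modSqDeriv ζ W s ξ with hy'
  have hderiv (s : ℝ) : HasDerivAt (fun s => (s + ρ) * modSq ζ W s ξ) (y' s) s := by
    refine (((hasDerivAt_id s).add_const ρ).fun_mul
      (hasDerivAt_modSq hζ hW.smooth s ξ)).congr_deriv ?_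
    simp [hy']
  have cmod := continuous_modSq_time hζ hW.smooth ξ
  have cfam := continuous_famSum_time (2 * m) hζ hW.smooth ξ
  have cder := continuous_modSqDeriv hζ hW.smooth ξ
  have cy' : Continuous y' := by fun_prop
  have hint : (t + ρ) * modSq ζ W t ξ = ∫ s in (-ρ)..t, y' s := by
    rw [intervalIntegral.integral_eq_sub_of_hasDerivAt (fun s _ => hderiv s)
      (cy'.intervalIntegrable _ _)]
    simp
  have hle : ∫ s in (-ρ)..t, jap ξ * y' s + c * jap ξ ^ (m + 1) * ((s + ρ) * modSq ζ W s ξ) ≤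
      ∫ s in (-ρ)..t, (C + 1) * jap ξ ^ m * famSum (2 * m) ζ W s ξ := by
    refine intervalIntegral.integral_mono_ae_restrict ht.1
      (Continuous.intervalIntegrable (by fun_prop) _ _)
      (Continuous.intervalIntegrable (by fun_prop) _ _) ?_
    have h1 : ∀ᵐ s ∂(volume.restrict (Icc (-ρ) t)), s ∈ Ioo (-ρ) t := by
      rw [← restrict_Ioo_eq_restrict_Icc]
      exact ae_restrict_mem measurableSet_Ioo
    have h2 : ∀ᵐ s ∂(volume.restrict (Icc (-ρ) t)), s ∈ Ioo (-1 : ℝ) 0 → _ :=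
      ae_restrict_of_ae ((ae_restrict_iff' measurableSet_Ioo).1 hW.eqn)
    filter_upwards [h1, h2] with s hs1 hs2
    have hs3 := hs2 ⟨by linarith [hs1.1], by linarith [hs1.2, ht.2]⟩
    have h3 := key (fun α β => A α β s) (fun α β i j => hA.bound α β s i j) (hA.leg s) ρ ζ hζ
      (fun j x => W j (s, x)) (fun i x => tder (W i) (s, x))
      (fun j => contDiff_slice (hW.smooth j) s) (fun x hx i => by
        rw [hs3 x (ball_subset_ball hρ1 hx) i]
        simp only [Dmul_slice]) ξ
    change jap ξ * modSqDeriv ζ W s ξ ≤ -c * jap ξ ^ (m + 1) * modSq ζ W s ξ +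
      C * jap ξ ^ m * famSum (2 * m) ζ W s ξ at h3
    have hs0 : 0 ≤ s + ρ := by linarith [hs1.1]
    have hs1' : s + ρ ≤ 1 := by linarith [hs1.2, ht.2]
    have h4 := mul_le_mul_of_nonneg_left h3 hs0
    have hG := famSum_nonneg (ζ := ζ) (W := W) (2 * m) s ξ
    have hP : 0 < jap ξ ^ m := pow_pos (jap_pos ξ) m
    have h5 : (s + ρ) * (C * jap ξ ^ m * famSum (2 * m) ζ W s ξ) ≤
        C * jap ξ ^ m * famSum (2 * m) ζ W s ξ :=
      mul_le_of_le_one_left (by positivity) hs1'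
    have h6 : jap ξ * modSq ζ W s ξ ≤ jap ξ ^ m * famSum (2 * m) ζ W s ξ :=
      mul_le_mul (le_self_pow₀ (one_le_jap ξ) (by omega)) (modSq_le_famSum _ _ _)
        (modSq_nonneg _ _) hP.le
    simp only [hy']
    linarith
  rw [hint, ← intervalIntegral.integral_const_mul, ← intervalIntegral.integral_const_mul,
    ← intervalIntegral.integral_const_mul, ← intervalIntegral.integral_add
      (Continuous.intervalIntegrable (by fun_prop) _ _)
      (Continuous.intervalIntegrable (by fun_prop) _ _)]
  exact hle

end TimeEnergy

section Interior

open FourierTransform Real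
open scoped ContDiff NNReal ENNReal ComplexConjugate

lemma lintegral_Ioo_ofReal {f : ℝ → ℝ} (hf : Continuous f) {a b : ℝ} (hab : a ≤ b)
    (h0 : ∀ t ∈ Ioo a b, 0 ≤ f t) :
    ∫⁻ t in Ioo a b, ENNReal.ofReal (f t) = ENNReal.ofReal (∫ t in a..b, f t) := by
  rw [intervalIntegral.integral_of_le hab, integral_Ioc_eq_integral_Ioo,
    ofReal_integral_eq_lintegral_ofReal
      (hf.continuousOn.integrableOn_Icc.mono_set Ioo_subset_Icc_self)
      ((ae_restrict_iff' measurableSet_Ioo).2 (Filter.Eventually.of_forall h0))]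

lemma energy_dissipation (d n : ℕ) {m : ℕ} (hm : 1 ≤ m) (K lam : ℝ) (hlam : 0 < lam) {ρ' ρ : ℝ}
    (h0 : 0 < ρ') (hρ : ρ' < ρ) (hρ1 : ρ ≤ 1) :
    ∃ C : ℝ≥0, ∀ A, IsCoef d n m K lam A → ∀ W, IsSol d n m A W →
      ∀ ζ : EuclideanSpace ℝ (Fin d) → ℂ, IsCut ρ ζ → ∀ ξ,
      ∫⁻ t in Ioo (-ρ') 0, ENNReal.ofReal (jap ξ * modSq ζ W t ξ) ≤
        C * ∫⁻ t in Ioo (-ρ) 0, ENNReal.ofReal (famSum (2 * m) ζ W t ξ) := by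
  obtain ⟨c, C, hc, hC, key⟩ := energy_integrated d n hm K lam hlam
  refine ⟨(C / (c * (ρ - ρ'))).toNNReal, fun A hA W hW ζ hζ ξ => ?_⟩
  have h1 := key A hA W hW ρ ζ hρ1 hζ ξ 0 ⟨by linarith, le_rfl⟩
  have cmod := continuous_modSq_time hζ hW.smooth ξ
  have cfam := continuous_famSum_time (2 * m) hζ hW.smooth ξ
  have hδ : 0 < ρ - ρ' := by linarith
  have hJ := jap_pos ξ
  have hY (t : ℝ) := modSq_nonneg (ζ := ζ) (W := W) t ξ
  have h2 : jap ξ * ∫ s in (-ρ)..0, (s + ρ) * modSq ζ W s ξ ≤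
      C / c * ∫ s in (-ρ)..0, famSum (2 * m) ζ W s ξ := by
    have h3 : 0 ≤ jap ξ * ((0 + ρ) * modSq ζ W 0 ξ) :=
      mul_nonneg hJ.le (mul_nonneg (by linarith) (hY 0))
    have hP : 0 < jap ξ ^ m := pow_pos hJ m
    rw [div_mul_eq_mul_div, le_div_iff₀ hc]
    refine le_of_mul_le_mul_left ?_ hP
    rw [pow_succ] at h1
    linarith
  calc _ ≤ ∫⁻ t in Ioo (-ρ) 0,
        ENNReal.ofReal ((ρ - ρ')⁻¹ * (jap ξ * ((t + ρ) * modSq ζ W t ξ))) := by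
        refine (setLIntegral_mono' measurableSet_Ioo fun t ht => ENNReal.ofReal_le_ofReal ?_).trans
          (lintegral_mono_set (Ioo_subset_Ioo_left (by linarith)))
        have h3 : 1 ≤ (ρ - ρ')⁻¹ * (t + ρ) := by
          rw [inv_mul_eq_div, le_div_iff₀ hδ]
          linarith [ht.1]
        calc _ ≤ (ρ - ρ')⁻¹ * (t + ρ) * (jap ξ * modSq ζ W t ξ) :=
              le_mul_of_one_le_left (mul_nonneg hJ.le (hY t)) h3
          _ = _ := by ring
    _ = ENNReal.ofReal ((ρ - ρ')⁻¹ * (jap ξ * ∫ t in (-ρ)..0, (t + ρ) * modSq ζ W t ξ)) := by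
        rw [lintegral_Ioo_ofReal (by fun_prop) (by linarith),
          intervalIntegral.integral_const_mul, intervalIntegral.integral_const_mul]
        intro t ht
        have : 0 ≤ t + ρ := by linarith [ht.1]
        have := hY t
        positivity
    _ ≤ ENNReal.ofReal (C / (c * (ρ - ρ')) * ∫ t in (-ρ)..0, famSum (2 * m) ζ W t ξ) := by
        refine ENNReal.ofReal_le_ofReal ?_
        refine (mul_le_mul_of_nonneg_left h2 (inv_pos.2 hδ).le).trans (le_of_eq ?_)
        field_simp
    _ = _ := by
        rw [ENNReal.ofReal_mul (by positivity), lintegral_Ioo_ofReal cfam (by linarith)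
          fun t _ => famSum_nonneg _ _ _]
        rfl

lemma energy_sup (d n : ℕ) {m : ℕ} (hm : 1 ≤ m) (K lam : ℝ) (hlam : 0 < lam) {ρ' ρ : ℝ}
    (h0 : 0 < ρ') (hρ : ρ' < ρ) (hρ1 : ρ ≤ 1) :
    ∃ C : ℝ≥0, ∀ A, IsCoef d n m K lam A → ∀ W, IsSol d n m A W →
      ∀ ζ : EuclideanSpace ℝ (Fin d) → ℂ, IsCut ρ ζ → ∀ ξ, ∀ t ∈ Ioo (-ρ') 0,
      ENNReal.ofReal (modSq ζ W t ξ) ≤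
        C * ∫⁻ t in Ioo (-ρ) 0, ENNReal.ofReal (jap ξ ^ (m - 1) * famSum (2 * m) ζ W t ξ) := by
  obtain ⟨c, C, hc, hC, key⟩ := energy_integrated d n hm K lam hlam
  refine ⟨(C / (ρ - ρ')).toNNReal, fun A hA W hW ζ hζ ξ t ht => ?_⟩
  have h1 := key A hA W hW ρ ζ hρ1 hζ ξ t ⟨by linarith [ht.1], ht.2.le⟩
  have cfam := continuous_famSum_time (2 * m) hζ hW.smooth ξ
  have hδ : 0 < ρ - ρ' := by linarith
  have hJ := jap_pos ξ
  have hY (t : ℝ) := modSq_nonneg (ζ := ζ) (W := W) t ξ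
  have hG (t : ℝ) := famSum_nonneg (ζ := ζ) (W := W) (2 * m) t ξ
  have h2 : 0 ≤ ∫ s in (-ρ)..t, (s + ρ) * modSq ζ W s ξ :=
    intervalIntegral.integral_nonneg (by linarith [ht.1]) fun s hs =>
      mul_nonneg (by linarith [hs.1]) (hY s)
  have h3 : ∫ s in (-ρ)..t, famSum (2 * m) ζ W s ξ ≤ ∫ s in (-ρ)..0, famSum (2 * m) ζ W s ξ :=
    intervalIntegral.integral_mono_interval le_rfl (by linarith [ht.1]) ht.2.le
      (Filter.Eventually.of_forall hG) (cfam.intervalIntegrable _ _)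
  have hI : 0 ≤ ∫ s in (-ρ)..0, famSum (2 * m) ζ W s ξ :=
    intervalIntegral.integral_nonneg (by linarith) fun s _ => hG s
  have h4 : (ρ - ρ') * modSq ζ W t ξ ≤
      C * (jap ξ ^ (m - 1) * ∫ s in (-ρ)..0, famSum (2 * m) ζ W s ξ) := by
    refine le_of_mul_le_mul_left ?_ hJ
    have e : jap ξ ^ m = jap ξ * jap ξ ^ (m - 1) := (mul_pow_sub_one (by omega) _).symm
    have h5 : (ρ - ρ') * modSq ζ W t ξ ≤ (t + ρ) * modSq ζ W t ξ :=
      mul_le_mul_of_nonneg_right (by linarith [ht.1]) (hY t)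
    have h6 := mul_le_mul_of_nonneg_left h5 hJ.le
    have h7 : 0 ≤ c * jap ξ ^ (m + 1) * ∫ s in (-ρ)..t, (s + ρ) * modSq ζ W s ξ := by positivity
    have h8 := mul_le_mul_of_nonneg_left h3 (by positivity : 0 ≤ C * jap ξ ^ m)
    have e2 : C * jap ξ ^ m * ∫ s in (-ρ)..0, famSum (2 * m) ζ W s ξ =
      jap ξ * (C * (jap ξ ^ (m - 1) * ∫ s in (-ρ)..0, famSum (2 * m) ζ W s ξ)) := by
      rw [e]; ring
    linarith
  calc _ ≤ ENNReal.ofReal (C / (ρ - ρ') *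
        (jap ξ ^ (m - 1) * ∫ s in (-ρ)..0, famSum (2 * m) ζ W s ξ)) := by
        refine ENNReal.ofReal_le_ofReal ?_
        rw [div_mul_eq_mul_div, le_div_iff₀ hδ, mul_comm]
        exact h4
    _ = _ := by
        rw [ENNReal.ofReal_mul (by positivity), lintegral_Ioo_ofReal (by fun_prop) (by linarith)
          fun t _ => mul_nonneg (by positivity) (hG t), intervalIntegral.integral_const_mul]
        rfl

variable {d n m : ℕ}

/-- Space-time squared Sobolev norm over the cylinder `(-ρ, 0) × B_ρ`. -/
noncomputable def cylSq (ρ : ℝ) (k : ℕ) (W : Fin n → ℝ × EuclideanSpace ℝ (Fin d) → ℂ) : ℝ≥0∞ :=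
  ∫⁻ t in Ioo (-ρ) 0, ∑ j, sobSq (ball 0 ρ) k fun x => W j (t, x)

lemma measurable_sobSq_slice (S : Set (EuclideanSpace ℝ (Fin d))) (k : ℕ)
    {V : ℝ × EuclideanSpace ℝ (Fin d) → ℂ} (hV : ContDiff ℝ ∞ V) :
    Measurable fun t => sobSq S k fun x => V (t, x) := by
  induction k generalizing V with
  | zero =>
    exact Measurable.lintegral_prod_right' (ν := volume.restrict S)
      (f := fun p => ‖V p‖ₑ ^ 2) (hV.continuous.enorm.measurable.pow_const 2)
  | succ k ih =>
    exact (ih hV).add (Finset.measurable_sum _ fun i _ => ih (contDiff_pder hV i))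

lemma sobSq_mono {S T : Set (EuclideanSpace ℝ (Fin d))} (h : S ⊆ T) (k : ℕ)
    (g : EuclideanSpace ℝ (Fin d) → ℂ) : sobSq S k g ≤ sobSq T k g := by
  induction k generalizing g with
  | zero => exact lintegral_mono_set h
  | succ k ih => exact add_le_add (ih g) (Finset.sum_le_sum fun i _ => ih _)

lemma cylSq_mono {ρ' ρ : ℝ} (h : ρ' ≤ ρ) (k : ℕ)
    (W : Fin n → ℝ × EuclideanSpace ℝ (Fin d) → ℂ) : cylSq ρ' k W ≤ cylSq ρ k W :=
  (lintegral_mono fun _ => Finset.sum_le_sum fun _ _ =>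
    sobSq_mono (ball_subset_ball h) k _).trans
      (lintegral_mono_set (Ioo_subset_Ioo_left (by linarith)))

lemma cylSq_succ (ρ : ℝ) (k : ℕ) {W : Fin n → ℝ × EuclideanSpace ℝ (Fin d) → ℂ}
    (hW : ∀ j, ContDiff ℝ ∞ (W j)) :
    cylSq ρ (k + 1) W = cylSq ρ k W + ∑ i, cylSq ρ k fun j => pder i (W j) := by
  unfold cylSq
  rw [← lintegral_finsetSum, ← lintegral_add_left]
  · refine lintegral_congr fun t => ?_
    rw [Finset.sum_comm, ← Finset.sum_add_distrib]
    rfl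
  · exact Finset.measurable_sum _ fun j _ => measurable_sobSq_slice _ _ (hW j)
  · exact fun i _ => Finset.measurable_sum _ fun j _ =>
      measurable_sobSq_slice _ _ (contDiff_pder (hW j) i)

lemma lintegral_swap_Ioo (ρ : ℝ) {f : ℝ × EuclideanSpace ℝ (Fin d) → ℝ} (hf : Continuous f) :
    ∫⁻ ξ, ∫⁻ t in Ioo (-ρ) 0, ENNReal.ofReal (f (t, ξ)) =
      ∫⁻ t in Ioo (-ρ) 0, ∫⁻ ξ, ENNReal.ofReal (f (t, ξ)) := by
  rw [lintegral_lintegral_swap]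
  exact ((ENNReal.continuous_ofReal.comp hf).measurable.comp measurable_swap).aemeasurable

lemma lintegral_famSum_le (n k M : ℕ) {ρ : ℝ} {ζ : EuclideanSpace ℝ (Fin d) → ℂ}
    (hζ : IsCut ρ ζ) :
    ∃ C : ℝ≥0, ∀ W : Fin n → ℝ × EuclideanSpace ℝ (Fin d) → ℂ, (∀ j, ContDiff ℝ ∞ (W j)) →
      ∫⁻ t in Ioo (-ρ) 0, ∫⁻ ξ, ENNReal.ofReal (jap ξ ^ k * famSum M ζ W t ξ) ≤
        C * cylSq ρ k W := by
  obtain ⟨C, hC⟩ := lintegral_jap_pow_famSq_le k M hζ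
  refine ⟨C, fun W hW => ?_⟩
  unfold cylSq
  rw [← lintegral_const_mul _ (Finset.measurable_sum _ fun j _ =>
    measurable_sobSq_slice _ _ (hW j))]
  refine lintegral_mono fun t => ?_
  have hs (j : Fin n) := contDiff_slice (hW j) t
  rw [Finset.mul_sum]
  calc _ = ∫⁻ ξ, ∑ j, ENNReal.ofReal (jap ξ ^ k * famSq M ζ (fun x => W j (t, x)) ξ) := by
        refine lintegral_congr fun ξ => ?_
        rw [famSum, Finset.mul_sum, ENNReal.ofReal_sum_of_nonneg]
        exact fun j _ => mul_nonneg (pow_nonneg (jap_pos ξ).le _) (famSq_nonneg _ _ _ _)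
    _ = ∑ j, ∫⁻ ξ, ENNReal.ofReal (jap ξ ^ k * famSq M ζ (fun x => W j (t, x)) ξ) := by
        refine lintegral_finsetSum _ fun j _ => (ENNReal.continuous_ofReal.comp ?_).measurable
        exact (continuous_jap.pow k).mul (continuous_famSq M hζ (hs j))
    _ ≤ _ := Finset.sum_le_sum fun j _ => hC _ (hs j)

end Interior

section Regularity

open FourierTransform Real
open scoped ContDiff NNReal ENNReal ComplexConjugate

lemma sobSq_pd_le_lintegral {d : ℕ} {ρ' ρ : ℝ} {ζ g : EuclideanSpace ℝ (Fin d) → ℂ}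
    (hζ : IsCut ρ ζ) (h1 : ∀ x ∈ ball 0 ρ', ζ x = 1) (hg : ContDiff ℝ ∞ g) (i : Fin d) :
    sobSq (ball 0 ρ') 0 (pd i g) ≤
      ∫⁻ ξ, ENNReal.ofReal (4 * π ^ 2 * (jap ξ * ‖𝓕 (fun x => ζ x * g x) ξ‖ ^ 2)) := by
  have e (x) (hx : x ∈ ball (0 : EuclideanSpace ℝ (Fin d)) ρ') :
      pd i g x = pd i (fun x => ζ x * g x) x := by
    have : g =ᶠ[𝓝 x] fun x => ζ x * g x := by
      filter_upwards [isOpen_ball.mem_nhds hx] with y hy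
      rw [h1 y hy, one_mul]
    exact congrArg (fun L : EuclideanSpace ℝ (Fin d) →L[ℝ] ℂ => L (EuclideanSpace.single i 1))
      (this.fderiv_eq (𝕜 := ℝ))
  calc _ = ∫⁻ x in ball 0 ρ', ‖pd i (fun x => ζ x * g x) x‖ₑ ^ 2 :=
        setLIntegral_congr_fun measurableSet_ball fun x hx => by
          rw [e x hx]
    _ ≤ ∫⁻ x, ‖pd i (fun x => ζ x * g x) x‖ₑ ^ 2 := setLIntegral_le_lintegral _ _
    _ = ∫⁻ ξ, ‖𝓕 (pd i fun x => ζ x * g x) ξ‖ₑ ^ 2 :=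
        ((hζ.mul hg).partial i).lintegral_fourier.symm
    _ ≤ _ := by
        refine lintegral_mono fun ξ => ?_
        rw [(hζ.mul hg).fourier_pd, enorm_sq_eq_ofReal, norm_mul, mul_pow, ← mul_assoc]
        exact ENNReal.ofReal_le_ofReal
          (mul_le_mul_of_nonneg_right (norm_fsym_sq_le ξ i) (sq_nonneg _))

lemma cylSq_pder_le (d n : ℕ) {m : ℕ} (hm : 1 ≤ m) (K lam : ℝ) (hlam : 0 < lam) {ρ' ρ : ℝ}
    (h0 : 0 < ρ') (hρ : ρ' < ρ) (hρ1 : ρ ≤ 1) :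
    ∃ C : ℝ≥0, ∀ A, IsCoef d n m K lam A → ∀ W, IsSol d n m A W → ∀ i,
      cylSq ρ' 0 (fun j => pder i (W j)) ≤ C * cylSq ρ 0 W := by
  obtain ⟨ζ, hζ, hζ1⟩ := exists_isCut (d := d) h0 hρ
  obtain ⟨C₁, h₁⟩ := energy_dissipation d n hm K lam hlam h0 hρ hρ1
  obtain ⟨C₂, h₂⟩ := lintegral_famSum_le n 0 (2 * m) hζ
  refine ⟨(4 * π ^ 2).toNNReal * (C₁ * C₂), fun A hA W hW i => ?_⟩
  have cmod := continuous_modSq hζ hW.smooth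
  have cfam := continuous_famSum (2 * m) hζ hW.smooth
  have cj : Continuous fun p : ℝ × EuclideanSpace ℝ (Fin d) => jap p.2 :=
    continuous_jap.comp continuous_snd
  calc cylSq ρ' 0 (fun j => pder i (W j))
      ≤ ∫⁻ t in Ioo (-ρ') 0, ∫⁻ ξ,
          ENNReal.ofReal (4 * π ^ 2 * (jap ξ * modSq ζ W t ξ)) := by
        refine lintegral_mono fun t => ?_
        have hs (j : Fin n) := contDiff_slice (hW.smooth j) t
        refine (Finset.sum_le_sum fun j _ =>
          sobSq_pd_le_lintegral hζ hζ1 (hs j) i).trans ?_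
        rw [← lintegral_finsetSum]
        · refine lintegral_mono fun ξ => ?_
          rw [modSq, Finset.mul_sum, Finset.mul_sum, ENNReal.ofReal_sum_of_nonneg]
          have := jap_pos ξ
          exact fun j _ => by positivity
        · intro j _
          refine (ENNReal.continuous_ofReal.comp (continuous_const.mul
            (continuous_jap.mul ?_))).measurable
          exact (hζ.mul (hs j)).continuous_fourier.norm.pow 2
    _ = (4 * π ^ 2).toNNReal * ∫⁻ t in Ioo (-ρ') 0, ∫⁻ ξ,
          ENNReal.ofReal (jap ξ * modSq ζ W t ξ) := by
        rw [← lintegral_const_mul' _ _ ENNReal.coe_ne_top]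
        refine lintegral_congr fun t => ?_
        rw [← lintegral_const_mul' _ _ ENNReal.coe_ne_top]
        refine lintegral_congr fun ξ => ?_
        rw [ENNReal.ofReal_mul (by positivity)]
        rfl
    _ = (4 * π ^ 2).toNNReal * ∫⁻ ξ, ∫⁻ t in Ioo (-ρ') 0,
          ENNReal.ofReal (jap ξ * modSq ζ W t ξ) := by
        rw [lintegral_swap_Ioo ρ' (f := fun p => jap p.2 * modSq ζ W p.1 p.2) (cj.mul cmod)]
    _ ≤ (4 * π ^ 2).toNNReal * ∫⁻ ξ, C₁ * ∫⁻ t in Ioo (-ρ) 0,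
          ENNReal.ofReal (famSum (2 * m) ζ W t ξ) := by
        gcongr with ξ
        exact h₁ A hA W hW ζ hζ ξ
    _ = (4 * π ^ 2).toNNReal * (C₁ * ∫⁻ t in Ioo (-ρ) 0, ∫⁻ ξ,
          ENNReal.ofReal (jap ξ ^ 0 * famSum (2 * m) ζ W t ξ)) := by
        rw [lintegral_const_mul' _ _ ENNReal.coe_ne_top, lintegral_swap_Ioo ρ cfam]
        simp only [pow_zero, one_mul]
    _ ≤ (4 * π ^ 2).toNNReal * (C₁ * (C₂ * cylSq ρ 0 W)) := by
        gcongr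
        exact h₂ W hW.smooth
    _ = _ := by push_cast; ring

lemma cylSq_le (d n : ℕ) {m : ℕ} (hm : 1 ≤ m) (K lam : ℝ) (hlam : 0 < lam) (k : ℕ) {ρ' ρ : ℝ}
    (h0 : 0 < ρ') (hρ : ρ' < ρ) (hρ1 : ρ ≤ 1) :
    ∃ C : ℝ≥0, ∀ A, IsCoef d n m K lam A → ∀ W, IsSol d n m A W →
      cylSq ρ' k W ≤ C * cylSq ρ 0 W := by
  induction k generalizing ρ' ρ with
  | zero => exact ⟨1, fun A hA W hW => by simpa using cylSq_mono hρ.le 0 W⟩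
  | succ k ih =>
    have h1 : ρ' < (ρ' + ρ) / 2 := by linarith
    have h2 : (ρ' + ρ) / 2 < ρ := by linarith
    obtain ⟨C₁, h₁⟩ := cylSq_pder_le d n hm K lam hlam (h0.trans h1) h2 hρ1
    obtain ⟨C₂, h₂⟩ := ih h0 hρ hρ1
    obtain ⟨C₃, h₃⟩ := ih h0 h1 (h2.le.trans hρ1)
    refine ⟨C₂ + d * (C₃ * C₁), fun A hA W hW => ?_⟩
    rw [cylSq_succ _ _ hW.smooth]
    calc _ ≤ C₂ * cylSq ρ 0 W + ∑ i : Fin d, C₃ * (C₁ * cylSq ρ 0 W) := by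
          gcongr with i
          · exact h₂ A hA W hW
          · refine (h₃ A hA _ (hW.partial i)).trans ?_
            gcongr
            exact h₁ A hA W hW i
      _ = _ := by
          simp only [Finset.sum_const, Finset.card_univ, Fintype.card_fin, nsmul_eq_mul]
          push_cast
          ring

/-- Interior boundedness of solutions in terms of their `L²` norm. -/
lemma enorm_sq_le_cylSq (d n : ℕ) {m : ℕ} (hm : 1 ≤ m) (K lam : ℝ) (hlam : 0 < lam) {ρ' ρ : ℝ}
    (h0 : 0 < ρ') (hρ : ρ' < ρ) (hρ1 : ρ ≤ 1) :
    ∃ C : ℝ≥0, ∀ A, IsCoef d n m K lam A → ∀ W, IsSol d n m A W →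
      ∀ t ∈ Ioo (-ρ') 0, ∀ x ∈ ball (0 : EuclideanSpace ℝ (Fin d)) ρ', ∀ j,
      ‖W j (t, x)‖ₑ ^ 2 ≤ C * cylSq ρ 0 W := by
  have hρ1' : ρ' < (ρ' + ρ) / 2 := by linarith
  have hρ2 : (ρ' + ρ) / 2 < ρ := by linarith
  set r := (ρ' + ρ) / 2
  obtain ⟨ζ, hζ, hζ1⟩ := exists_isCut (d := d) h0 hρ1'
  obtain ⟨C₁, h₁⟩ := enorm_sq_le_lintegral_jap d
  obtain ⟨C₂, h₂⟩ := energy_sup d n hm K lam hlam h0 hρ1' (hρ2.le.trans hρ1)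
  obtain ⟨C₃, h₃⟩ := lintegral_famSum_le n (2 * (d + 1) + (m - 1)) (2 * m) hζ
  obtain ⟨C₄, h₄⟩ := cylSq_le d n hm K lam hlam (2 * (d + 1) + (m - 1)) (h0.trans hρ1') hρ2 hρ1
  refine ⟨C₁ * (C₂ * (C₃ * C₄)), fun A hA W hW t ht x hx j => ?_⟩
  have hs := contDiff_slice (hW.smooth j) t
  have cfam := continuous_famSum (2 * m) hζ hW.smooth
  have cj : Continuous fun p : ℝ × EuclideanSpace ℝ (Fin d) => jap p.2 :=
    continuous_jap.comp continuous_snd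
  calc ‖W j (t, x)‖ₑ ^ 2 = ‖ζ x * W j (t, x)‖ₑ ^ 2 := by rw [hζ1 x hx, one_mul]
    _ ≤ C₁ * ∫⁻ ξ, ENNReal.ofReal (jap ξ ^ (2 * (d + 1)) *
          ‖𝓕 (fun x => ζ x * W j (t, x)) ξ‖ ^ 2) := h₁ _ _ (hζ.mul hs) x
    _ ≤ C₁ * ∫⁻ ξ, C₂ * ∫⁻ s in Ioo (-r) 0, ENNReal.ofReal
          (jap ξ ^ (2 * (d + 1) + (m - 1)) * famSum (2 * m) ζ W s ξ) := by
        gcongr with ξ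
        have hJ : 0 ≤ jap ξ ^ (2 * (d + 1)) := pow_nonneg (jap_pos ξ).le _
        calc _ ≤ ENNReal.ofReal (jap ξ ^ (2 * (d + 1)) * modSq ζ W t ξ) := by
              refine ENNReal.ofReal_le_ofReal (mul_le_mul_of_nonneg_left ?_ hJ)
              exact Finset.single_le_sum
                (f := fun j => ‖𝓕 (fun x => ζ x * W j (t, x)) ξ‖ ^ 2)
                (fun j _ => sq_nonneg _) (Finset.mem_univ j)
          _ ≤ ENNReal.ofReal (jap ξ ^ (2 * (d + 1))) * (C₂ * ∫⁻ s in Ioo (-r) 0,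
                ENNReal.ofReal (jap ξ ^ (m - 1) * famSum (2 * m) ζ W s ξ)) := by
              rw [ENNReal.ofReal_mul hJ]
              gcongr
              exact h₂ A hA W hW ζ hζ ξ t ht
          _ = _ := by
              rw [mul_left_comm, ← lintegral_const_mul' _ _ ENNReal.ofReal_ne_top]
              refine congrArg _ (lintegral_congr fun s => ?_)
              rw [← ENNReal.ofReal_mul hJ, ← mul_assoc, ← pow_add]
    _ = C₁ * (C₂ * ∫⁻ s in Ioo (-r) 0, ∫⁻ ξ, ENNReal.ofReal
          (jap ξ ^ (2 * (d + 1) + (m - 1)) * famSum (2 * m) ζ W s ξ)) := by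
        rw [lintegral_const_mul' _ _ ENNReal.coe_ne_top,
          lintegral_swap_Ioo r (f := fun p => jap p.2 ^ (2 * (d + 1) + (m - 1)) *
            famSum (2 * m) ζ W p.1 p.2) ((cj.pow _).mul cfam)]
    _ ≤ C₁ * (C₂ * (C₃ * (C₄ * cylSq ρ 0 W))) := by
        gcongr
        exact (h₃ W hW.smooth).trans (by gcongr; exact h₄ A hA W hW)
    _ = _ := by push_cast; ring

end Regularity

section Lipschitz

open scoped ContDiff NNReal ENNReal

lemma enorm_pds_sq_le_cylSq (d n : ℕ) {m : ℕ} (hm : 1 ≤ m) (K lam : ℝ) (hlam : 0 < lam)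
    (l : List (Fin d)) {ρ' ρ : ℝ} (h0 : 0 < ρ') (hρ : ρ' < ρ) (hρ1 : ρ ≤ 1) :
    ∃ C : ℝ≥0, ∀ A, IsCoef d n m K lam A → ∀ W, IsSol d n m A W →
      ∀ t ∈ Ioo (-ρ') 0, ∀ x ∈ ball (0 : EuclideanSpace ℝ (Fin d)) ρ', ∀ j,
      ‖pds l (fun y => W j (t, y)) x‖ₑ ^ 2 ≤ C * cylSq ρ 0 W := by
  induction l generalizing ρ' ρ with
  | nil => exact enorm_sq_le_cylSq d n hm K lam hlam h0 hρ hρ1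
  | cons i l ih =>
    have h1 : ρ' < (ρ' + ρ) / 2 := by linarith
    have h2 : (ρ' + ρ) / 2 < ρ := by linarith
    obtain ⟨C₁, h₁⟩ := cylSq_pder_le d n hm K lam hlam (h0.trans h1) h2 hρ1
    obtain ⟨C₂, h₂⟩ := ih h0 h1 (h2.le.trans hρ1)
    refine ⟨C₂ * C₁, fun A hA W hW t ht x hx j => ?_⟩
    have e : pds (i :: l) (fun y => W j (t, y)) = pds l fun y => pder i (W j) (t, y) :=
      (pds_pd (contDiff_slice (hW.smooth j) t) l i).symm
    rw [e]
    refine (h₂ A hA _ (hW.partial i) t ht x hx j).trans ?_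
    push_cast
    rw [mul_assoc]
    gcongr
    exact h₁ A hA W hW i

lemma norm_pds_le (d n : ℕ) {m : ℕ} (hm : 1 ≤ m) (K lam : ℝ) (hlam : 0 < lam)
    (l : List (Fin d)) :
    ∃ C : ℝ, 0 ≤ C ∧ ∀ A, IsCoef d n m K lam A → ∀ W, IsSol d n m A W → ∀ M : ℝ, 0 ≤ M →
      cylSq 1 0 W ≤ ENNReal.ofReal (M ^ 2) →
      ∀ t ∈ Ioo (-(1 / 2) : ℝ) 0, ∀ x ∈ ball (0 : EuclideanSpace ℝ (Fin d)) (1 / 2), ∀ j,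
      ‖pds l (fun y => W j (t, y)) x‖ ≤ C * M := by
  obtain ⟨C, h⟩ := enorm_pds_sq_le_cylSq d n hm K lam hlam l (ρ' := 1 / 2) (ρ := 1)
    (by norm_num) (by norm_num) le_rfl
  refine ⟨√C, Real.sqrt_nonneg _, fun A hA W hW M hM hcyl t ht x hx j => ?_⟩
  have h1 := (h A hA W hW t ht x hx j).trans (mul_le_mul_right hcyl _)
  rw [enorm_sq_eq_ofReal, ← ENNReal.ofReal_coe_nnreal, ← ENNReal.ofReal_mul C.coe_nonneg,
    ENNReal.ofReal_le_ofReal_iff (mul_nonneg C.coe_nonneg (sq_nonneg M))] at h1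
  refine le_of_sq_le_sq ?_ (by positivity)
  rwa [mul_pow, Real.sq_sqrt C.coe_nonneg]

lemma le_on_of_ae_restrict_le {X : Type*} [TopologicalSpace X] [MeasurableSpace X]
    [OpensMeasurableSpace X] {μ : Measure X} [μ.IsOpenPosMeasure] {S : Set X} (hS : IsOpen S)
    {f : X → ℝ} (hf : Continuous f) {c : ℝ} (h : ∀ᵐ x ∂(μ.restrict S), f x ≤ c) :
    ∀ x ∈ S, f x ≤ c := by
  intro x hx
  by_contra! hc
  have ho : IsOpen (S ∩ {y | c < f y}) := hS.inter (isOpen_lt continuous_const hf)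
  have h0 : μ (S ∩ {y | c < f y}) = 0 := by
    rw [ae_restrict_iff' hS.measurableSet, ae_iff] at h
    refine measure_mono_null (fun y hy => ?_) h
    simpa [not_le] using hy
  rw [ho.measure_eq_zero_iff μ] at h0
  exact (h0 ▸ (⟨hx, hc⟩ : x ∈ S ∩ {y | c < f y}) : x ∈ (∅ : Set X))

lemma norm_tder_le (d n : ℕ) {m : ℕ} (hm : 1 ≤ m) (K lam : ℝ) (hK : 0 ≤ K) (hlam : 0 < lam) :
    ∃ C : ℝ, 0 ≤ C ∧ ∀ A, IsCoef d n m K lam A → ∀ W, IsSol d n m A W → ∀ M : ℝ, 0 ≤ M →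
      cylSq 1 0 W ≤ ENNReal.ofReal (M ^ 2) →
      ∀ t ∈ Ioo (-(1 / 2) : ℝ) 0, ∀ x ∈ ball (0 : EuclideanSpace ℝ (Fin d)) (1 / 2), ∀ i,
      ‖tder (W i) (t, x)‖ ≤ C * M := by
  choose C hC0 hC using norm_pds_le d n hm K lam hlam
  refine ⟨∑ α ∈ MIdx d m, ∑ β ∈ MIdx d m, ∑ _j : Fin n, K * C (dirs (α + β)),
    Finset.sum_nonneg fun α _ => Finset.sum_nonneg fun β _ => Finset.sum_nonneg fun j _ =>
      mul_nonneg hK (hC0 _), fun A hA W hW M hM hcyl t ht x hx i => ?_⟩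
  have hc : Continuous fun s => ‖tder (W i) (s, x)‖ :=
    ((contDiff_tder (hW.smooth i)).continuous.comp (Continuous.prodMk_left x)).norm
  refine le_on_of_ae_restrict_le (μ := volume) isOpen_Ioo hc ?_ t ht
  have hsub : Ioo (-(1 / 2) : ℝ) 0 ⊆ Ioo (-1) 0 := Ioo_subset_Ioo_left (by norm_num)
  filter_upwards [ae_restrict_of_ae_restrict_of_subset hsub hW.eqn,
    ae_restrict_mem measurableSet_Ioo] with s hs hs'
  rw [hs x (ball_subset_ball (by norm_num) hx), norm_neg, norm_mul, norm_pow, norm_neg, norm_one,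
    one_pow, one_mul]
  simp only [Finset.sum_mul]
  refine (norm_sum_le _ _).trans (Finset.sum_le_sum fun α _ => (norm_sum_le _ _).trans
    (Finset.sum_le_sum fun β _ => (norm_sum_le _ _).trans (Finset.sum_le_sum fun j _ => ?_)))
  rw [norm_mul, Complex.norm_real, Real.norm_eq_abs, Dmul_slice, mul_assoc]
  exact mul_le_mul (hA.bound α β s i j) (hC _ A hA W hW M hM hcyl s hs' x hx j) (norm_nonneg _) hK

/-- Interior Lipschitz estimate for solutions in terms of their `L²` norm. -/
lemma norm_sub_le_of_isSol (d n : ℕ) {m : ℕ} (hm : 1 ≤ m) (K lam : ℝ) (hK : 0 ≤ K)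
    (hlam : 0 < lam) :
    ∃ C : ℝ, 0 ≤ C ∧ ∀ A, IsCoef d n m K lam A → ∀ W, IsSol d n m A W → ∀ M : ℝ, 0 ≤ M →
      cylSq 1 0 W ≤ ENNReal.ofReal (M ^ 2) →
      ∀ p ∈ Ioo (-(1 / 2) : ℝ) 0 ×ˢ ball (0 : EuclideanSpace ℝ (Fin d)) (1 / 2),
      ∀ q ∈ Ioo (-(1 / 2) : ℝ) 0 ×ˢ ball (0 : EuclideanSpace ℝ (Fin d)) (1 / 2), ∀ j,
      ‖W j p - W j q‖ ≤ C * M * ‖p - q‖ := by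
  obtain ⟨C₁, h₁0, h₁⟩ := norm_tder_le d n hm K lam hK hlam
  choose C hC0 hC using norm_pds_le d n hm K lam hlam
  have hS : 0 ≤ ∑ i : Fin d, C [i] := Finset.sum_nonneg fun i _ => hC0 _
  refine ⟨C₁ + ∑ i : Fin d, C [i], by positivity, fun A hA W hW M hM hcyl p hp q hq j => ?_⟩
  refine Convex.norm_image_sub_le_of_norm_fderiv_le (𝕜 := ℝ)
    (fun z _ => ((hW.smooth j).differentiable (by simp)).differentiableAt) (fun z hz => ?_)
    ((convex_Ioo _ _).prod (convex_ball _ _)) hq hp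
  refine ContinuousLinearMap.opNorm_le_bound _ (by positivity) fun v => ?_
  have e : v = v.1 • ((1 : ℝ), (0 : EuclideanSpace ℝ (Fin d))) +
      ∑ i, v.2 i • ((0 : ℝ), EuclideanSpace.single i (1 : ℝ)) := by
    refine Prod.ext ?_ ?_
    · simp [Prod.fst_sum]
    · ext k
      simp [Prod.snd_sum, Pi.single_apply]
  have e1 : fderiv ℝ (W j) z v = v.1 • tder (W j) z + ∑ i, v.2 i • pder i (W j) z := by
    conv_lhs => rw [e]
    simp only [map_add, map_sum, map_smul, tder_eq_fderiv (hW.smooth j),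
      pder_eq_fderiv (hW.smooth j)]
  rw [e1, add_mul, add_mul]
  refine (norm_add_le _ _).trans (add_le_add ?_ ((norm_sum_le _ _).trans ?_))
  · rw [norm_smul, mul_comm]
    exact mul_le_mul (h₁ A hA W hW M hM hcyl z.1 hz.1 z.2 hz.2 j) (norm_fst_le v)
      (norm_nonneg _) (by positivity)
  · simp only [Finset.sum_mul]
    refine Finset.sum_le_sum fun i _ => ?_
    rw [norm_smul, mul_comm]
    exact mul_le_mul (hC [i] A hA W hW M hM hcyl z.1 hz.1 z.2 hz.2 j)
      ((PiLp.norm_apply_le v.2 i).trans (norm_snd_le v)) (norm_nonneg _)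
      (mul_nonneg (hC0 _) hM)

end Lipschitz

section Rescaling

open scoped ContDiff NNReal ENNReal

variable {d n m : ℕ}

lemma pds_sub_const {l : List (Fin d)} (hl : l ≠ []) (g : EuclideanSpace ℝ (Fin d) → ℂ) (c : ℂ) :
    pds l (fun y => g y - c) = pds l g := by
  induction l with
  | nil => exact absurd rfl hl
  | cons i l ih =>
    rcases eq_or_ne l [] with rfl | h
    · funext x
      change fderiv ℝ (fun y => g y - c) x _ = fderiv ℝ g x _
      rw [fderiv_sub_const]
    · exact congrArg (pd i) (ih h)

lemma pds_comp_affine {g : EuclideanSpace ℝ (Fin d) → ℂ} (hg : ContDiff ℝ ∞ g)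
    (l : List (Fin d)) (x₀ : EuclideanSpace ℝ (Fin d)) (R : ℝ) :
    pds l (fun y => g (x₀ + R • y)) = fun x => (R : ℂ) ^ l.length * pds l g (x₀ + R • x) := by
  induction l with
  | nil => simp [pds]
  | cons i l ih =>
    funext x
    change fderiv ℝ (pds l fun y => g (x₀ + R • y)) x _ = _
    have h1 : HasFDerivAt (fun y : EuclideanSpace ℝ (Fin d) => x₀ + R • y)
        (R • ContinuousLinearMap.id ℝ (EuclideanSpace ℝ (Fin d))) x :=
      ((hasFDerivAt_id x).const_smul R).const_add x₀
    have h2 := (((contDiff_pds hg l).differentiable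
      (by simp)).differentiableAt (x := x₀ + R • x)).hasFDerivAt
    have h3 := (h2.comp x h1).const_mul ((R : ℂ) ^ l.length)
    simp only [Function.comp_def] at h3
    rw [ih, h3.fderiv]
    simp only [smul_apply, ContinuousLinearMap.comp_apply, ContinuousLinearMap.id_apply,
      map_smul, smul_eq_mul, Complex.real_smul, List.length_cons, pow_succ, mul_assoc]
    rfl

lemma Dmul_comp_clm {F : Type*} [NormedAddCommGroup F] [NormedSpace ℝ F]
    {u : ℝ × EuclideanSpace ℝ (Fin d) → F} (hu : ContDiff ℝ ∞ u) (γ : Fin d → ℕ) (L : F →L[ℝ] ℂ) :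
    Dmul γ (fun p => L (u p)) = (fun p => L (Dmul γ u p)) ∧ ContDiff ℝ ∞ (Dmul γ u) := by
  have h1 (i : Fin d) {v : ℝ × EuclideanSpace ℝ (Fin d) → F} (hv : ContDiff ℝ ∞ v) :
      pder i (fun p => L (v p)) = fun p => L (pder i v p) := by
    funext p
    have h2 := L.hasFDerivAt.comp p.2
      (((contDiff_slice hv p.1).differentiable (by simp)).differentiableAt (x := p.2)).hasFDerivAt
    exact congrArg (fun T : EuclideanSpace ℝ (Fin d) →L[ℝ] ℂ => T (EuclideanSpace.single i 1))
      h2.fderiv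
  have h3 (i : Fin d) (k : ℕ) {v : ℝ × EuclideanSpace ℝ (Fin d) → F} (hv : ContDiff ℝ ∞ v) :
      (pder i)^[k] (fun p => L (v p)) = (fun p => L ((pder i)^[k] v p)) ∧
        ContDiff ℝ ∞ ((pder i)^[k] v) := by
    induction k with
    | zero => exact ⟨rfl, hv⟩
    | succ k ih =>
      simp only [Function.iterate_succ_apply']
      rw [ih.1, h1 i ih.2]
      exact ⟨rfl, contDiff_pder ih.2 i⟩
  have h4 (l : List (Fin d)) :
      l.foldr (fun i v => (pder i)^[γ i] v) (fun p => L (u p)) =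
        (fun p => L (l.foldr (fun i v => (pder i)^[γ i] v) u p)) ∧
        ContDiff ℝ ∞ (l.foldr (fun i v => (pder i)^[γ i] v) u) := by
    induction l with
    | nil => exact ⟨rfl, hu⟩
    | cons i l ih =>
      simp only [List.foldr_cons]
      rw [ih.1]
      exact h3 i _ ih.2
  exact h4 _

lemma map_affine {E : Type*} [NormedAddCommGroup E] [NormedSpace ℝ E] [MeasurableSpace E]
    [BorelSpace E] [FiniteDimensional ℝ E] (μ : Measure E) [μ.IsAddHaarMeasure] (x₀ : E) {R : ℝ}
    (hR : 0 < R) : μ.map (fun x => x₀ + R • x) =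
      ENNReal.ofReal ((R ^ Module.finrank ℝ E)⁻¹) • μ := by
  have e : (fun x : E => x₀ + R • x) = (fun x => x₀ + x) ∘ fun x => R • x := rfl
  rw [e, ← Measure.map_map (measurable_const_add x₀) (measurable_const_smul R),
    Measure.map_addHaar_smul μ hR.ne', Measure.map_smul, map_add_left_eq_self,
    abs_of_pos (by positivity)]

lemma setLIntegral_comp_affine {E : Type*} [NormedAddCommGroup E] [NormedSpace ℝ E]
    [MeasurableSpace E] [BorelSpace E] [FiniteDimensional ℝ E] (μ : Measure E)
    [μ.IsAddHaarMeasure] (x₀ : E) {R : ℝ} (hR : 0 < R) {f : E → ℝ≥0∞} (hf : Measurable f)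
    {T : Set E} (hT : MeasurableSet T) :
    ∫⁻ x in (fun x => x₀ + R • x) ⁻¹' T, f (x₀ + R • x) ∂μ =
      ENNReal.ofReal ((R ^ Module.finrank ℝ E)⁻¹) * ∫⁻ y in T, f y ∂μ := by
  have hm : Measurable fun x : E => x₀ + R • x := (measurable_const_smul R).const_add x₀
  rw [← setLIntegral_map hT hf hm, map_affine μ x₀ hR, Measure.restrict_smul, lintegral_smul_measure, smul_eq_mul]

lemma preimage_affine_Ioo (t₀ : ℝ) {a : ℝ} (ha : 0 < a) :
    (fun t => t₀ + a • t) ⁻¹' Ioo (t₀ - a) t₀ = Ioo (-1) 0 := by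
  ext t
  simp only [mem_preimage, mem_Ioo, smul_eq_mul]
  constructor <;> rintro ⟨h1, h2⟩ <;> constructor <;> nlinarith

lemma preimage_affine_ball {E : Type*} [NormedAddCommGroup E] [NormedSpace ℝ E] (x₀ : E) {R : ℝ}
    (hR : 0 < R) : (fun x => x₀ + R • x) ⁻¹' ball x₀ R = ball 0 1 := by
  ext x
  simp [norm_smul, abs_of_pos hR, hR]

/-- Complexified components of the parabolic rescaling of `u - c`. -/
noncomputable def rescale (m : ℕ) (u : ℝ × EuclideanSpace ℝ (Fin d) → EuclideanSpace ℝ (Fin n))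
    (c : EuclideanSpace ℝ (Fin n)) (X₀ : ℝ × EuclideanSpace ℝ (Fin d)) (R : ℝ) (j : Fin n)
    (p : ℝ × EuclideanSpace ℝ (Fin d)) : ℂ :=
  (u (X₀.1 + R ^ (2 * m) • p.1, X₀.2 + R • p.2) j : ℂ) - (c j : ℂ)

variable {u : ℝ × EuclideanSpace ℝ (Fin d) → EuclideanSpace ℝ (Fin n)}

/-- The `j`-th coordinate as a complex-valued functional. -/
noncomputable def coordL (j : Fin n) : EuclideanSpace ℝ (Fin n) →L[ℝ] ℂ :=
  Complex.ofRealCLM.comp (EuclideanSpace.proj j)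

lemma contDiff_rescale (hu : ContDiff ℝ ∞ u) (c : EuclideanSpace ℝ (Fin n))
    (X₀ : ℝ × EuclideanSpace ℝ (Fin d)) (R : ℝ) (j : Fin n) :
    ContDiff ℝ ∞ (rescale m u c X₀ R j) := by
  have h : ContDiff ℝ ∞ fun p : ℝ × EuclideanSpace ℝ (Fin d) =>
      (X₀.1 + R ^ (2 * m) • p.1, X₀.2 + R • p.2) :=
    (contDiff_const.add (contDiff_fst.const_smul _)).prodMk
      (contDiff_const.add (contDiff_snd.const_smul _))
  exact ((coordL j).contDiff.comp (hu.comp h)).sub contDiff_const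

lemma tder_rescale (hu : ContDiff ℝ ∞ u) (c : EuclideanSpace ℝ (Fin n))
    (X₀ : ℝ × EuclideanSpace ℝ (Fin d)) (R : ℝ) (j : Fin n) (t : ℝ)
    (x : EuclideanSpace ℝ (Fin d)) :
    tder (rescale m u c X₀ R j) (t, x) =
      R ^ (2 * m) * (tder u (X₀.1 + R ^ (2 * m) • t, X₀.2 + R • x) j : ℂ) := by
  have h1 : HasDerivAt (fun s : ℝ => X₀.1 + R ^ (2 * m) • s) (R ^ (2 * m)) t := by
    simpa using ((hasDerivAt_id t).const_smul (R ^ (2 * m))).const_add X₀.1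
  have h2 := (hasDerivAt_tder hu (X₀.1 + R ^ (2 * m) • t) (X₀.2 + R • x)).scomp t h1
  have h3 := ((coordL j).hasFDerivAt.comp_hasDerivAt t h2).sub_const (c j : ℂ)
  refine h3.deriv.trans ?_
  rw [map_smul, Complex.real_smul]
  push_cast
  rfl

lemma Dmul_rescale (hu : ContDiff ℝ ∞ u) (c : EuclideanSpace ℝ (Fin n))
    (X₀ : ℝ × EuclideanSpace ℝ (Fin d)) (R : ℝ) (j : Fin n) {γ : Fin d → ℕ}
    (hγ : dirs γ ≠ []) (t : ℝ) (x : EuclideanSpace ℝ (Fin d)) :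
    Dmul γ (rescale m u c X₀ R j) (t, x) =
      R ^ (dirs γ).length * (Dmul γ u (X₀.1 + R ^ (2 * m) • t, X₀.2 + R • x) j : ℂ) := by
  have hs : ContDiff ℝ ∞ fun y => coordL j (u (X₀.1 + R ^ (2 * m) • t, y)) :=
    (coordL j).contDiff.comp (contDiff_slice hu _)
  have h1 := congrFun (Dmul_comp_clm hu γ (coordL j)).1 (X₀.1 + R ^ (2 * m) • t, X₀.2 + R • x)
  rw [Dmul_slice] at h1 ⊢
  have h2 := congrFun (pds_comp_affine hs (dirs γ) X₀.2 R) x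
  rw [h1] at h2
  refine (congrFun (pds_sub_const hγ _ _) x).trans h2

lemma ae_forall_ball_of_ae_QCyl
    {A : (Fin d → ℕ) → (Fin d → ℕ) → ℝ → Fin n → Fin n → ℝ} (hu : ContDiff ℝ ∞ u) {r : ℝ}
    {X : ℝ × EuclideanSpace ℝ (Fin d)}
    (h : ∀ᵐ p ∂(volume.restrict (QCyl d m r X)), ∀ i,
        tder u p i + (-1 : ℝ) ^ m * ∑ α ∈ MIdx d m, ∑ β ∈ MIdx d m, ∑ j,
          A α β p.1 i j * Dmul (α + β) u p j = 0) :
    ∀ᵐ t ∂(volume.restrict (Ioo (X.1 - r ^ (2 * m)) X.1)), ∀ x ∈ ball X.2 r, ∀ i,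
        tder u (t, x) i + (-1 : ℝ) ^ m * ∑ α ∈ MIdx d m, ∑ β ∈ MIdx d m, ∑ j,
          A α β t i j * Dmul (α + β) u (t, x) j = 0 := by
  rw [QCyl, Measure.volume_eq_prod, ← Measure.prod_restrict] at h
  filter_upwards [Measure.ae_ae_of_ae_prod h] with t ht x hx i
  have cc {v : ℝ × EuclideanSpace ℝ (Fin d) → EuclideanSpace ℝ (Fin n)} (hv : ContDiff ℝ ∞ v)
      (j : Fin n) : Continuous fun y => v (t, y) j :=
    (EuclideanSpace.proj (𝕜 := ℝ) j).continuous.comp (contDiff_slice hv t).continuous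
  have hc : Continuous fun y => ‖tder u (t, y) i + (-1 : ℝ) ^ m * ∑ α ∈ MIdx d m,
      ∑ β ∈ MIdx d m, ∑ j, A α β t i j * Dmul (α + β) u (t, y) j‖ :=
    ((cc (contDiff_tder hu) i).add (continuous_const.mul (continuous_finsetSum _ fun α _ =>
      continuous_finsetSum _ fun β _ => continuous_finsetSum _ fun j _ =>
        continuous_const.mul (cc (Dmul_comp_clm hu (α + β) (coordL i)).2 j)))).norm
  refine norm_le_zero_iff.1 (le_on_of_ae_restrict_le (μ := volume) isOpen_ball hc ?_ x hx)
  filter_upwards [ht] with y hy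
  exact norm_le_zero_iff.2 (hy i)

lemma isSol_rescale (hm : 1 ≤ m)
    {A : (Fin d → ℕ) → (Fin d → ℕ) → ℝ → Fin n → Fin n → ℝ} (hu : ContDiff ℝ ∞ u) {R : ℝ}
    (hR : 0 < R) {X₀ : ℝ × EuclideanSpace ℝ (Fin d)}
    (h : ∀ᵐ p ∂(volume.restrict (QCyl d m R X₀)), ∀ i,
        tder u p i + (-1 : ℝ) ^ m * ∑ α ∈ MIdx d m, ∑ β ∈ MIdx d m, ∑ j,
          A α β p.1 i j * Dmul (α + β) u p j = 0) (c : EuclideanSpace ℝ (Fin n)) :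
    IsSol d n m (fun α β t => A α β (X₀.1 + R ^ (2 * m) • t)) (rescale m u c X₀ R) := by
  refine ⟨contDiff_rescale hu c X₀ R, ?_⟩
  have ha : 0 < R ^ (2 * m) := by positivity
  have h1 := (ae_restrict_iff' measurableSet_Ioo).1 (ae_forall_ball_of_ae_QCyl hu h)
  have h2 := ae_of_ae_map
    (f := fun t => X₀.1 + R ^ (2 * m) • t)
    ((measurable_const_smul (R ^ (2 * m))).const_add X₀.1).aemeasurable
    (p := _) (μ := (volume : Measure ℝ)) (by
      rw [map_affine volume X₀.1 ha]
      exact Measure.ae_smul_measure h1 _)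
  rw [ae_restrict_iff' measurableSet_Ioo]
  filter_upwards [h2] with t ht ht1 x hx i
  rw [← preimage_affine_Ioo X₀.1 ha] at ht1
  rw [← preimage_affine_ball X₀.2 hR] at hx
  have h3 := ht ht1 (X₀.2 + R • x) hx i
  rw [tder_rescale hu, eq_neg_of_add_eq_zero_left h3]
  push_cast
  rw [mul_neg, mul_left_comm, Finset.mul_sum]
  refine congrArg _ (congrArg _ (Finset.sum_congr rfl fun α hα => ?_))
  rw [Finset.mul_sum]
  refine Finset.sum_congr rfl fun β hβ => ?_
  rw [Finset.mul_sum]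
  refine Finset.sum_congr rfl fun j _ => ?_
  have hl := length_dirs_add hα hβ
  rw [Dmul_rescale hu c X₀ R j (fun h0 => by simp [h0] at hl; omega), hl]
  exact mul_left_comm _ _ _

lemma integrableOn_QCyl {F : Type*} [NormedAddCommGroup F] {f : ℝ × EuclideanSpace ℝ (Fin d) → F}
    (hf : Continuous f) (r : ℝ) (X : ℝ × EuclideanSpace ℝ (Fin d)) :
    IntegrableOn f (QCyl d m r X) :=
  (hf.continuousOn.integrableOn_compact (isCompact_Icc.prod (isCompact_closedBall X.2 r))).mono_set
    (prod_mono Ioo_subset_Icc_self ball_subset_closedBall)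

lemma cylSq_rescale (hu : ContDiff ℝ ∞ u) {R : ℝ} (hR : 0 < R)
    (X₀ : ℝ × EuclideanSpace ℝ (Fin d)) (c : EuclideanSpace ℝ (Fin n)) :
    cylSq 1 0 (rescale m u c X₀ R) =
      ENNReal.ofReal ((R ^ (2 * m + d))⁻¹ * ∫ p in QCyl d m R X₀, ‖u p - c‖ ^ 2) := by
  have ha : 0 < R ^ (2 * m) := by positivity
  have hc : Continuous fun p => ‖u p - c‖ ^ 2 := (hu.continuous.sub continuous_const).norm.pow 2
  have hG : Measurable fun p => ENNReal.ofReal (‖u p - c‖ ^ 2) :=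
    (ENNReal.continuous_ofReal.comp hc).measurable
  have e (t : ℝ) (x : EuclideanSpace ℝ (Fin d)) : ∑ j, ‖rescale m u c X₀ R j (t, x)‖ₑ ^ 2 =
      ENNReal.ofReal (‖u (X₀.1 + R ^ (2 * m) • t, X₀.2 + R • x) - c‖ ^ 2) := by
    simp only [enorm_sq_eq_ofReal]
    rw [← ENNReal.ofReal_sum_of_nonneg fun j _ => sq_nonneg _, EuclideanSpace.norm_sq_eq]
    refine congrArg _ (Finset.sum_congr rfl fun j _ => ?_)
    rw [rescale, ← Complex.ofReal_sub, Complex.norm_real]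
    rfl
  calc cylSq 1 0 (rescale m u c X₀ R)
      = ∫⁻ t in Ioo (-1 : ℝ) 0, ∫⁻ x in ball (0 : EuclideanSpace ℝ (Fin d)) 1,
          ENNReal.ofReal (‖u (X₀.1 + R ^ (2 * m) • t, X₀.2 + R • x) - c‖ ^ 2) := by
        refine lintegral_congr fun t => ?_
        simp only [sobSq, ← e]
        rw [lintegral_finsetSum]
        exact fun j _ => (contDiff_slice (contDiff_rescale hu c X₀ R j)
          t).continuous.enorm.measurable.pow_const 2
    _ = ∫⁻ t in Ioo (-1 : ℝ) 0, ENNReal.ofReal ((R ^ d)⁻¹) * ∫⁻ y in ball X₀.2 R,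
          ENNReal.ofReal (‖u (X₀.1 + R ^ (2 * m) • t, y) - c‖ ^ 2) := by
        refine lintegral_congr fun t => ?_
        have := setLIntegral_comp_affine volume X₀.2 hR
          (hG.comp (measurable_prodMk_left (x := X₀.1 + R ^ (2 * m) • t)))
          (measurableSet_ball (x := X₀.2) (ε := R))
        rw [preimage_affine_ball X₀.2 hR, finrank_euclideanSpace_fin] at this
        exact this
    _ = ENNReal.ofReal ((R ^ d)⁻¹) * (ENNReal.ofReal ((R ^ (2 * m))⁻¹) *
          ∫⁻ s in Ioo (X₀.1 - R ^ (2 * m)) X₀.1, ∫⁻ y in ball X₀.2 R,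
          ENNReal.ofReal (‖u (s, y) - c‖ ^ 2)) := by
        rw [lintegral_const_mul' _ _ ENNReal.ofReal_ne_top]
        have := setLIntegral_comp_affine volume X₀.1 ha
          (hG.lintegral_prod_right' (ν := volume.restrict (ball X₀.2 R)))
          (measurableSet_Ioo (a := X₀.1 - R ^ (2 * m)) (b := X₀.1))
        rw [preimage_affine_Ioo X₀.1 ha, Module.finrank_self, pow_one] at this
        rw [← this]
    _ = ENNReal.ofReal ((R ^ (2 * m + d))⁻¹) *
          ∫⁻ p in QCyl d m R X₀, ENNReal.ofReal (‖u p - c‖ ^ 2) := by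
        rw [← mul_assoc, ← ENNReal.ofReal_mul (by positivity), ← mul_inv, ← pow_add,
          add_comm d, QCyl, Measure.volume_eq_prod, ← Measure.prod_restrict,
          lintegral_prod _ hG.aemeasurable]
    _ = _ := by
        rw [ENNReal.ofReal_mul (by positivity), ofReal_integral_eq_lintegral_ofReal
          (integrableOn_QCyl hc R X₀) (Filter.Eventually.of_forall fun p => sq_nonneg _)]

lemma volume_QCyl {r : ℝ} (hr : 0 < r) (X : ℝ × EuclideanSpace ℝ (Fin d)) :
    volume.real (QCyl d m r X) =
      r ^ (2 * m + d) * volume.real (ball (0 : EuclideanSpace ℝ (Fin d)) 1) := by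
  rw [Measure.real, QCyl, Measure.volume_eq_prod, Measure.prod_prod, Real.volume_Ioo,
    Measure.addHaar_ball_of_pos volume X.2 hr, finrank_euclideanSpace_fin, ENNReal.toReal_mul,
    ENNReal.toReal_mul, sub_sub_cancel, ENNReal.toReal_ofReal (by positivity),
    ENNReal.toReal_ofReal (by positivity), pow_add, mul_assoc]
  rfl

lemma QCyl_subset {r R : ℝ} (hr : 0 ≤ r) (h : r ≤ R) (X : ℝ × EuclideanSpace ℝ (Fin d)) :
    QCyl d m r X ⊆ QCyl d m R X :=
  prod_mono (Ioo_subset_Ioo_left (sub_le_sub_left (pow_le_pow_left₀ hr h _) _)) (ball_subset_ball h)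

lemma QCyl_subset_two_mul (hm : 1 ≤ m) {R : ℝ} (hR : 0 < R) {X₀ : ℝ × EuclideanSpace ℝ (Fin d)}
    (hX : X₀ ∈ QCyl d m R 0) : QCyl d m R X₀ ⊆ QCyl d m (2 * R) 0 := by
  obtain ⟨⟨h1, h2⟩, h3⟩ := hX
  have h4 : 2 ^ 1 * R ^ (2 * m) ≤ (2 * R) ^ (2 * m) := by
    rw [mul_pow]
    gcongr
    · norm_num
    · omega
  simp only [Prod.fst_zero] at h1 h2
  refine prod_mono (Ioo_subset_Ioo ?_ h2.le) (ball_subset_ball' ?_)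
  · simp only [Prod.fst_zero]
    linarith
  · rw [mem_ball] at h3
    linarith

/-- The average minimizes the mean square deviation. -/
lemma setIntegral_norm_sub_average_sq_le {X F : Type*} [MeasurableSpace X] {μ : Measure X}
    [NormedAddCommGroup F] [InnerProductSpace ℝ F] [CompleteSpace F] {S : Set X} (hS : μ S ≠ ⊤)
    {u : X → F} (hu : IntegrableOn u S μ) (hu2 : ∀ c, IntegrableOn (fun p => ‖u p - c‖ ^ 2) S μ)
    (c : F) :
    ∫ p in S, ‖u p - ⨍ q in S, u q ∂μ‖ ^ 2 ∂μ ≤ ∫ p in S, ‖u p - c‖ ^ 2 ∂μ := by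
  have : IsFiniteMeasure (μ.restrict S) := ⟨by simpa using hS.lt_top⟩
  set a := ⨍ q in S, u q ∂μ with ha
  have h0 : ∫ p in S, inner ℝ (a - c) (u p - a) ∂μ = 0 := by
    have hi : Integrable (fun p => u p - a) (μ.restrict S) := hu.sub (integrable_const a)
    rw [integral_inner hi (a - c), ha, integral_sub_average, inner_zero_right]
  have hi : Integrable (fun p => inner ℝ (a - c) (u p - a)) (μ.restrict S) :=
    (hu.sub (integrable_const a)).const_inner (a - c)
  have h1 : ∫ p in S, (‖u p - a‖ ^ 2 + 2 * inner ℝ (a - c) (u p - a)) ∂μ ≤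
      ∫ p in S, ‖u p - c‖ ^ 2 ∂μ := by
    refine integral_mono ((hu2 a).add (hi.const_mul 2)) (hu2 c) fun p => ?_
    have e : u p - c = (u p - a) + (a - c) := by abel
    change ‖u p - a‖ ^ 2 + 2 * inner ℝ (a - c) (u p - a) ≤ ‖u p - c‖ ^ 2
    rw [e, norm_add_sq_real, real_inner_comm]
    nlinarith [sq_nonneg ‖a - c‖]
  rwa [integral_add (hu2 a) (hi.const_mul 2), integral_const_mul, h0, mul_zero, add_zero] at h1

end Rescaling

section Decay

open scoped ContDiff

/-- Oscillation of a solution in a small cylinder, in terms of its deviation from a constant. -/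
lemma norm_sub_le_of_QCyl (d n : ℕ) {m : ℕ} (hm : 1 ≤ m) (K lam : ℝ) (hK : 0 ≤ K)
    (hlam : 0 < lam) :
    ∃ C : ℝ, 0 ≤ C ∧ ∀ A, IsCoef d n m K lam A →
      ∀ u : ℝ × EuclideanSpace ℝ (Fin d) → EuclideanSpace ℝ (Fin n), ContDiff ℝ ∞ u →
      ∀ R : ℝ, 0 < R → ∀ X₀ : ℝ × EuclideanSpace ℝ (Fin d),
      (∀ᵐ p ∂(volume.restrict (QCyl d m R X₀)), ∀ i,
        tder u p i + (-1 : ℝ) ^ m * ∑ α ∈ MIdx d m, ∑ β ∈ MIdx d m, ∑ j,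
          A α β p.1 i j * Dmul (α + β) u p j = 0) →
      ∀ r : ℝ, 0 < r → r ≤ R / 2 → ∀ c, ∀ p ∈ QCyl d m r X₀, ∀ q ∈ QCyl d m r X₀,
        ‖u p - u q‖ ^ 2 ≤ C * (r / R) ^ 2 *
          ((R ^ (2 * m + d))⁻¹ * ∫ p in QCyl d m R X₀, ‖u p - c‖ ^ 2) := by
  obtain ⟨C, hC0, hC⟩ := norm_sub_le_of_isSol d n hm K lam hK hlam
  refine ⟨n * (2 * C) ^ 2, by positivity, fun A hA u hu R hR X₀ h r hr hrR c p hp q hq => ?_⟩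
  set I := (R ^ (2 * m + d))⁻¹ * ∫ p in QCyl d m R X₀, ‖u p - c‖ ^ 2 with hI
  have hI0 : 0 ≤ I := mul_nonneg (by positivity) (integral_nonneg fun p => sq_nonneg _)
  have ha : 0 < R ^ (2 * m) := by positivity
  have hA' : IsCoef d n m K lam fun α β t => A α β (X₀.1 + R ^ (2 * m) • t) :=
    ⟨fun α β t => hA.bound α β _, fun t => hA.leg _⟩
  have hW := isSol_rescale hm hu hR h c
  have hcyl : cylSq 1 0 (rescale m u c X₀ R) ≤ ENNReal.ofReal (√I ^ 2) := by
    rw [Real.sq_sqrt hI0, cylSq_rescale hu hR]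
  have hrR1 : r / R ≤ 1 / 2 := by
    rw [div_le_div_iff₀ hR two_pos]
    linarith
  have hrR0 : 0 ≤ r / R := by positivity
  have hpow : (r / R) ^ (2 * m) ≤ r / R :=
    pow_le_of_le_one hrR0 (by linarith) (by omega)
  let φ : ℝ × EuclideanSpace ℝ (Fin d) → ℝ × EuclideanSpace ℝ (Fin d) := fun z =>
    ((R ^ (2 * m))⁻¹ * (z.1 - X₀.1), R⁻¹ • (z.2 - X₀.2))
  have hφ {z : ℝ × EuclideanSpace ℝ (Fin d)} (hz : z ∈ QCyl d m r X₀) :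
      φ z ∈ Ioo (-(r / R)) 0 ×ˢ ball (0 : EuclideanSpace ℝ (Fin d)) (r / R) := by
    obtain ⟨⟨h1, h2⟩, h3⟩ := hz
    refine ⟨⟨?_, ?_⟩, ?_⟩
    · refine (neg_le_neg hpow).trans_lt ?_
      rw [div_pow, div_eq_inv_mul, ← mul_neg]
      exact mul_lt_mul_of_pos_left (by linarith) (inv_pos.2 ha)
    · exact mul_neg_of_pos_of_neg (inv_pos.2 ha) (by linarith)
    · rw [mem_ball, dist_eq_norm] at h3
      rw [mem_ball_zero_iff, norm_smul, norm_inv, Real.norm_of_nonneg hR.le, div_eq_inv_mul]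
      exact mul_lt_mul_of_pos_left h3 (inv_pos.2 hR)
  have hφ' {z : ℝ × EuclideanSpace ℝ (Fin d)} (hz : z ∈ QCyl d m r X₀) :
      φ z ∈ Ioo (-(1 / 2) : ℝ) 0 ×ˢ ball (0 : EuclideanSpace ℝ (Fin d)) (1 / 2) :=
    prod_mono (Ioo_subset_Ioo_left (neg_le_neg hrR1)) (ball_subset_ball hrR1) (hφ hz)
  have hinv (z : ℝ × EuclideanSpace ℝ (Fin d)) (j : Fin n) :
      rescale m u c X₀ R j (φ z) = (u z j : ℂ) - (c j : ℂ) := by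
    have e1 : X₀.1 + R ^ (2 * m) • (φ z).1 = z.1 := by
      simp only [φ, smul_eq_mul]
      field_simp
      ring
    have e2 : X₀.2 + R • (φ z).2 = z.2 := by
      simp only [φ]
      rw [smul_inv_smul₀ hR.ne', add_sub_cancel]
    rw [rescale, e1, e2]
  have hdist : ‖φ p - φ q‖ ≤ 2 * (r / R) := by
    obtain ⟨⟨p1, p2⟩, p3⟩ := hφ hp
    obtain ⟨⟨q1, q2⟩, q3⟩ := hφ hq
    refine norm_prod_le_iff.2 ⟨?_, ?_⟩
    · rw [Prod.fst_sub, Real.norm_eq_abs, abs_le]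
      constructor <;> linarith
    · rw [mem_ball_zero_iff] at p3 q3
      refine (norm_sub_le _ _).trans ?_
      linarith
  rw [EuclideanSpace.norm_sq_eq]
  calc ∑ j, ‖(u p - u q) j‖ ^ 2 ≤ ∑ _j : Fin n, (C * √I * (2 * (r / R))) ^ 2 := by
        refine Finset.sum_le_sum fun j _ => pow_le_pow_left₀ (norm_nonneg _) ?_ 2
        have h1 := hC _ hA' _ hW _ (Real.sqrt_nonneg I) hcyl _ (hφ' hp) _ (hφ' hq) j
        rw [hinv, hinv, sub_sub_sub_cancel_right, ← Complex.ofReal_sub, Complex.norm_real] at h1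
        exact h1.trans (mul_le_mul_of_nonneg_left hdist (by positivity))
    _ = _ := by
        simp only [Finset.sum_const, Finset.card_univ, Fintype.card_fin, nsmul_eq_mul, mul_pow,
          Real.sq_sqrt hI0]
        ring

end Decay

/-- Interior oscillation decay estimate for solutions of homogeneous
higher-order parabolic systems with simple (time-dependent) coefficients. -/
theorem statement_4 (d n m : ℕ) (hd : 1 ≤ d) (hn : 1 ≤ n) (hm : 1 ≤ m)
    (K lam : ℝ) (hK : 0 ≤ K) (hlam : 0 < lam) :
    ∃ C : ℝ, 0 < C ∧
      ∀ A : (Fin d → ℕ) → (Fin d → ℕ) → ℝ → Fin n → Fin n → ℝ,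
      (∀ α β i j, Measurable fun t => A α β t i j) →
      (∀ α β t i j, |A α β t i j| ≤ K) →
      (∀ t : ℝ, LegHad d n m lam (fun α β => A α β t)) →
      ∀ R : ℝ, 0 < R →
      ∀ u : ℝ × EuclideanSpace ℝ (Fin d) → EuclideanSpace ℝ (Fin n),
      ContDiff ℝ (⊤ : ℕ∞) u →
      (∀ᵐ p ∂(volume.restrict (QCyl d m (2 * R) 0)), ∀ i,
        tder u p i + (-1 : ℝ) ^ m * ∑ α ∈ MIdx d m, ∑ β ∈ MIdx d m, ∑ j,
          A α β p.1 i j * Dmul (α + β) u p j = 0) →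
      ∀ X₀ ∈ QCyl d m R (0 : ℝ × EuclideanSpace ℝ (Fin d)), ∀ r : ℝ, 0 < r → r < R →
        (∫ p in QCyl d m r X₀, ‖u p - ⨍ q in QCyl d m r X₀, u q‖ ^ 2) ≤
          C * (r / R) ^ (2 + 2 * m + d) *
            ∫ p in QCyl d m R X₀, ‖u p - ⨍ q in QCyl d m R X₀, u q‖ ^ 2 := by
  obtain ⟨C, hC0, hC⟩ := norm_sub_le_of_QCyl d n hm K lam hK hlam
  set ω := volume.real (ball (0 : EuclideanSpace ℝ (Fin d)) 1)
  have hω : 0 ≤ ω := measureReal_nonneg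
  refine ⟨C * ω + 2 ^ (2 + 2 * m + d), by positivity,
    fun A _ hAb hAl R hR u hu h X₀ hX₀ r hr hrR => ?_⟩
  have hsol := ae_restrict_of_ae_restrict_of_subset (QCyl_subset_two_mul hm hR hX₀) h
  set c := ⨍ q in QCyl d m R X₀, u q
  set J := ∫ p in QCyl d m R X₀, ‖u p - c‖ ^ 2 with hJ
  have hJ0 : 0 ≤ J := integral_nonneg fun p => sq_nonneg _
  have hint (c' : EuclideanSpace ℝ (Fin n)) (ρ : ℝ) :
      IntegrableOn (fun p => ‖u p - c'‖ ^ 2) (QCyl d m ρ X₀) :=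
    integrableOn_QCyl ((hu.continuous.sub continuous_const).norm.pow 2) ρ X₀
  have hfin : volume (QCyl d m r X₀) < ⊤ := by
    rw [QCyl, Measure.volume_eq_prod, Measure.prod_prod]
    exact ENNReal.mul_lt_top (by simp) measure_ball_lt_top
  have hmin := setIntegral_norm_sub_average_sq_le hfin.ne
    (integrableOn_QCyl hu.continuous r X₀) fun c' => hint c' r
  have hrR0 : 0 ≤ (r / R) ^ (2 + 2 * m + d) := by positivity
  rcases le_or_gt r (R / 2) with h2 | h2
  · have hq : ((X₀.1 - r ^ (2 * m) / 2, X₀.2) : ℝ × EuclideanSpace ℝ (Fin d)) ∈ QCyl d m r X₀ := by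
      have : 0 < r ^ (2 * m) := by positivity
      refine ⟨⟨?_, ?_⟩, mem_ball_self hr⟩ <;> simp only <;> linarith
    refine (hmin (u (X₀.1 - r ^ (2 * m) / 2, X₀.2))).trans ?_
    have hb := norm_setIntegral_le_of_norm_le_const hfin
      (f := fun p => ‖u p - u (X₀.1 - r ^ (2 * m) / 2, X₀.2)‖ ^ 2) fun p hp =>
      (Real.norm_of_nonneg (sq_nonneg _)).trans_le
        (hC A ⟨hAb, hAl⟩ u hu R hR X₀ hsol r hr h2 c p hp _ hq)
    refine (Real.le_norm_self _).trans (hb.trans ?_)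
    rw [volume_QCyl hr]
    calc C * (r / R) ^ 2 * ((R ^ (2 * m + d))⁻¹ * J) * (r ^ (2 * m + d) * ω)
        = C * ω * (r / R) ^ (2 + 2 * m + d) * J := by
          rw [add_assoc 2, pow_add _ 2, div_pow r R (2 * m + d)]
          ring
      _ ≤ _ := by
          gcongr
          linarith [show (0 : ℝ) < 2 ^ (2 + 2 * m + d) by positivity]
  · refine (hmin c).trans ((setIntegral_mono_set (hint c R)
      (Filter.Eventually.of_forall fun p => sq_nonneg _)
      (QCyl_subset hr.le hrR.le X₀).eventuallyLE).trans ?_)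
    have h1 : 1 ≤ 2 ^ (2 + 2 * m + d) * (r / R) ^ (2 + 2 * m + d) := by
      rw [← mul_pow]
      refine one_le_pow₀ ?_
      rw [← mul_div_assoc, le_div_iff₀ hR]
      linarith
    refine (le_mul_of_one_le_left hJ0 (h1.trans ?_))
    gcongr
    linarith [mul_nonneg hC0 hω]
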